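/- The Ramanujan g-invariant at 58 satisfies g₅₈² = (5 + √29)/2; that is, with q = exp(−π√58) and k = θ₂(q)²/θ₃(q)², one has ((1−k²)/(2k))^{1/6} = (5+√29)/2. -/

import Mathlib

open Real Filter

/-- The one-variable Jacobi theta function `θ₂(q) = ∑_{n ∈ ℤ} q^((n + 1/2)²)`. -/
noncomputable def theta2 (q : ℝ) : ℝ := ∑' n : ℤ, q ^ (((n : ℝ) + 1 / 2) ^ 2)

/-- The one-variable Jacobi theta function `θ₃(q) = ∑_{n ∈ ℤ} q^(n²)`. -/
noncomputable def theta3 (q : ℝ) : ℝ := ∑' n : ℤ, q ^ ((n : ℝ) ^ 2)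

/-- The singular value `k_r = λ*(r) = θ₂(q)²/θ₃(q)²` with `q = exp(−π√r)`. -/
noncomputable def kSing (r : ℝ) : ℝ :=
  theta2 (Real.exp (-(π * Real.sqrt r))) ^ 2 / theta3 (Real.exp (-(π * Real.sqrt r))) ^ 2

/-- The Ramanujan g-invariant `g_r = ((1 − k_r²)/(2 k_r))^(1/12)`. -/
noncomputable def gRam (r : ℝ) : ℝ := ((1 - kSing r ^ 2) / (2 * kSing r)) ^ ((1 : ℝ) / 12)

/-- The integral points with `u² + 58 v² = n`. -/
def normFiber (n : ℤ) : Set (ℤ × ℤ) := {z | z.1 ^ 2 + 58 * z.2 ^ 2 = n}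

theorem normFiber_finite (n : ℤ) : (normFiber n).Finite := by
  refine (Set.Finite.prod (Set.finite_Icc (-n) n) (Set.finite_Icc (-n) n)).subset ?_
  rintro ⟨u, v⟩ h
  simp only [normFiber, Set.mem_ofPred_eq] at h
  simp only [Set.mem_prod, Set.mem_Icc]
  have h1 : u ≤ u ^ 2 := Int.le_self_sq u
  have h2 : -u ≤ u ^ 2 := by simpa using Int.le_self_sq (-u)
  have h3 : v ≤ v ^ 2 := Int.le_self_sq v
  have h4 : -v ≤ v ^ 2 := by simpa using Int.le_self_sq (-v)
  refine ⟨⟨?_, ?_⟩, ?_, ?_⟩ <;> nlinarith [sq_nonneg u, sq_nonneg v]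

/-- The number of representations of `n` by `u² + 58 v²`. -/
noncomputable def repCount (n : ℤ) : ℕ := (normFiber n).ncard

theorem even_of_sq_add_mul_sq {u v n : ℤ} (h : u ^ 2 + 58 * v ^ 2 = 2 * n) : Even u := by
  have : Even (u ^ 2) := ⟨n - 29 * v ^ 2, by linarith⟩
  exact (Int.even_pow.mp this).1

theorem repCount_sq_mul {p n : ℤ} (hp : p ≠ 0)
    (h : ∀ u v : ℤ, u ^ 2 + 58 * v ^ 2 = p * p * n → p ∣ u ∧ p ∣ v) :
    repCount (p * p * n) = repCount n := by
  have himg : normFiber (p * p * n) = (fun z : ℤ × ℤ => (p * z.1, p * z.2)) '' normFiber n := by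
    ext ⟨u, v⟩
    simp only [normFiber, Set.mem_ofPred_eq, Set.mem_image, Prod.mk.injEq, Prod.exists]
    constructor
    · intro huv
      obtain ⟨⟨a, rfl⟩, ⟨b, rfl⟩⟩ := h u v huv
      refine ⟨a, b, ?_, rfl, rfl⟩
      have : p * p * (a ^ 2 + 58 * b ^ 2) = p * p * n := by linarith
      exact mul_left_cancel₀ (mul_ne_zero hp hp) this
    · rintro ⟨a, b, hab, rfl, rfl⟩
      rw [← hab]; ring
  rw [repCount, repCount, himg, Set.ncard_image_of_injective]
  rintro ⟨a, b⟩ ⟨c, d⟩ hx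
  simpa [hp] using hx

theorem repCount_four_mul (n : ℤ) : repCount (4 * n) = repCount n := by
  have := repCount_sq_mul (p := 2) (n := n) two_ne_zero ?_
  · simpa using this
  intro u v h
  have hu : Even u := even_of_sq_add_mul_sq (n := 2 * n) (v := v) (by linarith)
  obtain ⟨a, rfl⟩ := hu
  have hv : Even (v ^ 2) := by
    have : Even (29 * v ^ 2) := ⟨n - a ^ 2, by linarith⟩
    rcases Int.even_mul.mp this with h | h
    · exact absurd h (by decide)
    · exact h
  exact ⟨⟨a, by ring⟩, (Int.even_pow.mp hv).1.two_dvd⟩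

theorem repCount_mul_twentyNine (n : ℤ) : repCount (29 * n) = repCount (2 * n) := by
  have himg : normFiber (29 * n) = (fun z : ℤ × ℤ => (29 * z.2, z.1 / 2)) '' normFiber (2 * n) := by
    ext ⟨u, v⟩
    simp only [normFiber, Set.mem_ofPred_eq, Set.mem_image, Prod.mk.injEq, Prod.exists]
    constructor
    · intro huv
      have h29 : (29 : ℤ) ∣ u ^ 2 := ⟨n - 2 * v ^ 2, by linarith⟩
      obtain ⟨a, rfl⟩ := (by norm_num : Prime (29 : ℤ)).dvd_of_dvd_pow h29
      exact ⟨2 * v, a, by linarith, rfl, by simp⟩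
    · rintro ⟨a, b, hab, rfl, rfl⟩
      obtain ⟨c, rfl⟩ := (even_of_sq_add_mul_sq hab).two_dvd
      simp only [ne_eq, OfNat.ofNat_ne_zero, not_false_eq_true, Int.mul_ediv_cancel_left]
      linarith
  rw [repCount, repCount, himg, Set.InjOn.ncard_image]
  rintro ⟨a, b⟩ hab ⟨c, d⟩ hcd hx
  obtain ⟨a', rfl⟩ := (even_of_sq_add_mul_sq hab).two_dvd
  obtain ⟨c', rfl⟩ := (even_of_sq_add_mul_sq hcd).two_dvd
  simp only [Prod.mk.injEq] at hx ⊢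
  omega

/-- The points of norm `p n` with both coordinates divisible by `p`. -/
theorem ncard_dvd_normFiber {p : ℤ} (hp : p ≠ 0) (n : ℤ) :
    ({z ∈ normFiber (p * n) | p ∣ z.1 ∧ p ∣ z.2}).ncard =
      if p ∣ n then repCount (n / p) else 0 := by
  split_ifs with hpn
  · obtain ⟨m, rfl⟩ := hpn
    rw [Int.mul_ediv_cancel_left _ hp]
    have himg : {z ∈ normFiber (p * (p * m)) | p ∣ z.1 ∧ p ∣ z.2} =
        (fun z : ℤ × ℤ => (p * z.1, p * z.2)) '' normFiber m := by
      ext ⟨u, v⟩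
      simp only [normFiber, Set.mem_ofPred_eq, Set.mem_image, Prod.mk.injEq, Prod.exists]
      constructor
      · rintro ⟨huv, ⟨a, rfl⟩, ⟨b, rfl⟩⟩
        refine ⟨a, b, ?_, rfl, rfl⟩
        have : p * p * (a ^ 2 + 58 * b ^ 2) = p * p * m := by linarith
        exact mul_left_cancel₀ (mul_ne_zero hp hp) this
      · rintro ⟨a, b, hab, rfl, rfl⟩
        refine ⟨?_, dvd_mul_right _ _, dvd_mul_right _ _⟩
        rw [← hab]; ring
    rw [himg, repCount, Set.ncard_image_of_injective]
    rintro ⟨a, b⟩ ⟨c, d⟩ hx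
    simpa [hp] using hx
  · convert Set.ncard_empty (ℤ × ℤ)
    ext ⟨u, v⟩
    simp only [normFiber, Set.mem_ofPred_eq, Set.mem_empty_iff_false, iff_false]
    rintro ⟨huv, ⟨a, rfl⟩, ⟨b, rfl⟩⟩
    apply hpn
    refine ⟨a ^ 2 + 58 * b ^ 2, mul_left_cancel₀ hp ?_⟩
    linarith

/-- If `π` has norm `k p` with `k ∈ {1, 2}`, multiplication by `π / k` identifies points of norm
`k n` with points of norm `p n` in the lattice `u ≡ b v (mod p)`. -/
theorem ncard_normFiber_residue {p b x y k : ℤ} (hp : Prime p) (hp2 : ¬ p ∣ 2)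
    (hb : p ∣ b ^ 2 + 58) (hk : k = 1 ∨ k = 2) (hxy : x ^ 2 + 58 * y ^ 2 = k * p)
    (hbx : p ∣ x - b * y) (n : ℤ) :
    ({z ∈ normFiber (p * n) | p ∣ z.1 - b * z.2}).ncard = repCount (k * n) := by
  have hp0 : p ≠ 0 := hp.ne_zero
  have hk0 : k ≠ 0 := by rcases hk with rfl | rfl <;> norm_num
  have hpk : ¬ p ∣ k := by
    rcases hk with rfl | rfl
    · exact fun h => hp.not_isUnit (isUnit_of_dvd_one h)
    · exact hp2
  refine Set.ncard_congr
    (fun z _ => ((z.1 * x + 58 * z.2 * y) / p, (z.2 * x - z.1 * y) / p)) ?_ ?_ ?_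
  all_goals
    have hdvd : ∀ u v : ℤ, p ∣ u - b * v → p ∣ u * x + 58 * v * y ∧ p ∣ v * x - u * y := by
      rintro u v ⟨c, hc⟩
      obtain ⟨d, hd⟩ := hbx
      obtain ⟨e, he⟩ := hb
      have hu : u = b * v + p * c := by linarith
      have hx : x = b * y + p * d := by linarith
      subst hu hx
      exact ⟨⟨e * v * y + b * v * d + c * (b * y + p * d), by linear_combination v * y * he⟩,
        ⟨v * d - c * y, by ring⟩⟩
  · rintro ⟨u, v⟩ ⟨huv, hres⟩
    obtain ⟨⟨s, hs⟩, ⟨t, ht⟩⟩ := hdvd u v hres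
    simp only [normFiber, Set.mem_ofPred_eq] at huv ⊢
    rw [hs, ht, Int.mul_ediv_cancel_left _ hp0, Int.mul_ediv_cancel_left _ hp0]
    refine mul_left_cancel₀ (mul_ne_zero hp0 hp0) ?_
    have : (p * s) ^ 2 + 58 * (p * t) ^ 2 = (u ^ 2 + 58 * v ^ 2) * (x ^ 2 + 58 * y ^ 2) := by
      rw [← hs, ← ht]; ring
    rw [huv, hxy] at this
    linarith
  · rintro ⟨u, v⟩ ⟨u', v'⟩ ⟨huv, hres⟩ ⟨huv', hres'⟩ heq
    obtain ⟨⟨s, hs⟩, ⟨t, ht⟩⟩ := hdvd u v hres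
    obtain ⟨⟨s', hs'⟩, ⟨t', ht'⟩⟩ := hdvd u' v' hres'
    simp only [hs, ht, hs', ht', Int.mul_ediv_cancel_left _ hp0, Prod.mk.injEq] at heq
    obtain ⟨rfl, rfl⟩ := heq
    have h1 : (k * p) * u = (k * p) * u' := by
      rw [← hxy]; linear_combination x * (hs - hs') - 58 * y * (ht - ht')
    have h2 : (k * p) * v = (k * p) * v' := by
      rw [← hxy]; linear_combination y * (hs - hs') + x * (ht - ht')
    simp only [Prod.mk.injEq]
    exact ⟨mul_left_cancel₀ (mul_ne_zero hk0 hp0) h1, mul_left_cancel₀ (mul_ne_zero hk0 hp0) h2⟩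
  · rintro ⟨s, t⟩ hst
    simp only [normFiber, Set.mem_ofPred_eq] at hst
    obtain ⟨⟨u, hu⟩, ⟨v, hv⟩⟩ : k ∣ x * s - 58 * y * t ∧ k ∣ x * t + y * s := by
      rcases hk with rfl | rfl
      · exact ⟨one_dvd _, one_dvd _⟩
      · obtain ⟨x', rfl⟩ := (even_of_sq_add_mul_sq hxy).two_dvd
        obtain ⟨s', rfl⟩ := (even_of_sq_add_mul_sq hst).two_dvd
        exact ⟨⟨2 * x' * s' - 29 * y * t, by ring⟩, ⟨x' * t + y * s', by ring⟩⟩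
    have h1 : u * x + 58 * v * y = p * s := by
      refine mul_left_cancel₀ hk0 ?_
      linear_combination -x * hu - 58 * y * hv + s * hxy
    have h2 : v * x - u * y = p * t := by
      refine mul_left_cancel₀ hk0 ?_
      linear_combination -x * hv + y * hu + t * hxy
    refine ⟨(u, v), ⟨?_, ?_⟩, ?_⟩
    · simp only [normFiber, Set.mem_ofPred_eq]
      refine mul_left_cancel₀ (mul_ne_zero hk0 hk0) ?_
      have : (k * u) ^ 2 + 58 * (k * v) ^ 2 = (x ^ 2 + 58 * y ^ 2) * (s ^ 2 + 58 * t ^ 2) := by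
        rw [← hu, ← hv]; ring
      rw [hxy, hst] at this
      linarith
    · refine (hp.dvd_or_dvd (?_ : p ∣ k * (u - b * v))).resolve_left hpk
      obtain ⟨d, hd⟩ := hbx
      obtain ⟨e, he⟩ := hb
      have hx : x = b * y + p * d := by linarith
      refine ⟨d * s - e * y * t - b * d * t, ?_⟩
      subst hx
      linear_combination -hu + b * hv - y * t * he
    · simp only [h1, h2, Int.mul_ediv_cancel_left _ hp0]

/-- Counting points of norm `p n` when `p` splits. -/
theorem repCount_prime_mul {p b x y k : ℤ} (hp : Prime p) (hp2 : ¬ p ∣ 2) (hp58 : ¬ p ∣ 58)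
    (hb : p ∣ b ^ 2 + 58) (hk : k = 1 ∨ k = 2) (hxy : x ^ 2 + 58 * y ^ 2 = k * p)
    (hbx : p ∣ x - b * y) (n : ℤ) :
    repCount (p * n) + (if p ∣ n then repCount (n / p) else 0) = 2 * repCount (k * n) := by
  have hpb : ¬ p ∣ b := fun h => hp58 ((Int.dvd_add_right (h.trans (Dvd.intro_left b (by ring)))).mp hb)
  have hunion : normFiber (p * n) = {z ∈ normFiber (p * n) | p ∣ z.1 - b * z.2} ∪
      {z ∈ normFiber (p * n) | p ∣ z.1 - (-b) * z.2} := by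
    ext ⟨u, v⟩
    simp only [Set.mem_union, Set.mem_ofPred_eq, ← and_or_left]
    refine ⟨fun h => ⟨h, hp.dvd_or_dvd ?_⟩, fun h => h.1⟩
    simp only [normFiber, Set.mem_ofPred_eq] at h
    obtain ⟨e, he⟩ := hb
    exact ⟨n - e * v ^ 2, by linear_combination h - v ^ 2 * he⟩
  have hinter : {z ∈ normFiber (p * n) | p ∣ z.1 - b * z.2} ∩
      {z ∈ normFiber (p * n) | p ∣ z.1 - (-b) * z.2} =
      {z ∈ normFiber (p * n) | p ∣ z.1 ∧ p ∣ z.2} := by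
    ext ⟨u, v⟩
    simp only [Set.mem_inter_iff, Set.mem_ofPred_eq]
    constructor
    · rintro ⟨⟨h, h1⟩, -, h2⟩
      have hu : p ∣ 2 * u := by
        have := dvd_add h1 h2
        ring_nf at this
        rwa [mul_comm]
      have hu := (hp.dvd_or_dvd hu).resolve_left hp2
      have hv : p ∣ b * v := by
        have := dvd_sub hu h1
        ring_nf at this
        exact this
      exact ⟨h, hu, (hp.dvd_or_dvd hv).resolve_left hpb⟩
    · rintro ⟨h, h1, h2⟩
      exact ⟨⟨h, dvd_sub h1 (h2.mul_left _)⟩, h, dvd_sub h1 (h2.mul_left _)⟩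
  have hcard := Set.ncard_union_add_ncard_inter
    {z ∈ normFiber (p * n) | p ∣ z.1 - b * z.2} {z ∈ normFiber (p * n) | p ∣ z.1 - (-b) * z.2}
    ((normFiber_finite _).subset (Set.sep_subset _ _))
    ((normFiber_finite _).subset (Set.sep_subset _ _))
  rw [← hunion, hinter, ncard_dvd_normFiber hp.ne_zero,
    ncard_normFiber_residue hp hp2 hb hk hxy hbx,
    ncard_normFiber_residue (b := -b) (x := -x) (y := y) hp hp2 (by simpa using hb) hk
      (by simpa using hxy) (by rw [← dvd_neg]; simpa [sub_eq_add_neg, add_comm] using hbx)] at hcard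
  rw [repCount, hcard]
  ring

theorem dvd_of_dvd_sq_add_mul_sq {l : ℕ} [Fact l.Prime] (h : ∀ x : ZMod l, x ^ 2 ≠ -58)
    {u v : ℤ} (hd : (l : ℤ) ∣ u ^ 2 + 58 * v ^ 2) : (l : ℤ) ∣ u ∧ (l : ℤ) ∣ v := by
  rw [← ZMod.intCast_zmod_eq_zero_iff_dvd] at hd
  push_cast at hd
  have hv : (v : ZMod l) = 0 := by
    by_contra hv
    apply h ((u : ZMod l) / v)
    field_simp
    linear_combination hd
  have hu : (u : ZMod l) = 0 := by
    rw [hv] at hd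
    simpa using hd
  exact ⟨(ZMod.intCast_zmod_eq_zero_iff_dvd _ _).mp hu, (ZMod.intCast_zmod_eq_zero_iff_dvd _ _).mp hv⟩

theorem exists_lattice_point_le (p : ℕ) (hp : p ≠ 0) (b : ℤ) (U V : ℕ)
    (h : p < (U + 1) * (V + 1)) :
    ∃ u v : ℤ, (u ≠ 0 ∨ v ≠ 0) ∧ |u| ≤ U ∧ |v| ≤ V ∧ (p : ℤ) ∣ u - b * v := by
  have : NeZero p := ⟨hp⟩
  have hcard : (Finset.univ : Finset (ZMod p)).card <
      (Finset.range (U + 1) ×ˢ Finset.range (V + 1)).card := by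
    simpa [ZMod.card] using h
  obtain ⟨⟨i, j⟩, hij, ⟨i', j'⟩, hij', hne, heq⟩ :=
    Finset.exists_ne_map_eq_of_card_lt_of_maps_to hcard
      (f := fun z : ℕ × ℕ => ((z.1 : ZMod p) - (b : ZMod p) * (z.2 : ZMod p)))
      (fun _ _ => Finset.mem_univ _)
  simp only [Finset.mem_product, Finset.mem_range] at hij hij'
  simp only [ne_eq, Prod.mk.injEq, not_and_or] at hne
  refine ⟨(i : ℤ) - i', (j : ℤ) - j', ?_, ?_, ?_, ?_⟩
  · omega
  · rw [abs_le]; omega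
  · rw [abs_le]; omega
  · rw [← ZMod.intCast_zmod_eq_zero_iff_dvd]
    push_cast
    linear_combination heq

theorem exists_smaller_multiple {p l : ℕ} [hp : Fact p.Prime] [hl : Fact l.Prime]
    (h : ∀ x : ZMod l, x ^ 2 ≠ -58) {b u v : ℤ} {k : ℕ} (hb : (p : ℤ) ∣ b ^ 2 + 58)
    (huv : u ^ 2 + 58 * v ^ 2 = k * p) (hres : (p : ℤ) ∣ u - b * v) (hlk : l ∣ k) :
    ∃ (k' : ℕ) (u' v' : ℤ), k = l * l * k' ∧ u' ^ 2 + 58 * v' ^ 2 = k' * p ∧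
      (p : ℤ) ∣ u' - b * v' := by
  have hpl : p ≠ l := by
    rintro rfl
    rw [← ZMod.intCast_zmod_eq_zero_iff_dvd] at hb
    push_cast at hb
    exact h b (by linear_combination hb)
  have hl0 : (l : ℤ) ≠ 0 := by exact_mod_cast hl.out.ne_zero
  obtain ⟨⟨u', rfl⟩, ⟨v', rfl⟩⟩ := dvd_of_dvd_sq_add_mul_sq h (u := u) (v := v)
    (huv ▸ (Int.natCast_dvd_natCast.mpr hlk).mul_right _)
  obtain ⟨j, rfl⟩ := hlk
  push_cast at huv
  have h1 : (l : ℤ) * (u' ^ 2 + 58 * v' ^ 2) = j * p := by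
    refine mul_left_cancel₀ hl0 ?_
    linear_combination huv
  have hlj : (l : ℤ) ∣ j * p := ⟨_, h1.symm⟩
  have hcop : IsCoprime (l : ℤ) p :=
    Nat.isCoprime_iff_coprime.mpr ((Nat.coprime_primes hl.out hp.out).mpr hpl.symm)
  obtain ⟨k', rfl⟩ := Int.natCast_dvd_natCast.mp (hcop.dvd_of_dvd_mul_right hlj)
  refine ⟨k', u', v', by ring, ?_, ?_⟩
  · refine mul_left_cancel₀ hl0 ?_
    push_cast at h1
    linear_combination h1
  · refine hcop.symm.dvd_of_dvd_mul_left (?_ : (p : ℤ) ∣ l * (u' - b * v'))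
    convert hres using 1
    ring

theorem exists_smaller_multiple_four {p : ℕ} [hp : Fact p.Prime] (hp2 : p ≠ 2) {b u v : ℤ} {k : ℕ}
    (huv : u ^ 2 + 58 * v ^ 2 = (4 * k : ℕ) * p) (hres : (p : ℤ) ∣ u - b * v) :
    ∃ u' v' : ℤ, u' ^ 2 + 58 * v' ^ 2 = k * p ∧ (p : ℤ) ∣ u' - b * v' := by
  push_cast at huv
  obtain ⟨u', rfl⟩ := (even_of_sq_add_mul_sq (u := u) (v := v) (n := 2 * k * p) (by linarith)).two_dvd
  have hv : Even (v ^ 2) := by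
    have : Even (29 * v ^ 2) := ⟨k * p - u' ^ 2, by linarith⟩
    rcases Int.even_mul.mp this with h | h
    · exact absurd h (by decide)
    · exact h
  obtain ⟨v', rfl⟩ := (Int.even_pow.mp hv).1.two_dvd
  refine ⟨u', v', by linarith, ?_⟩
  have hcop : IsCoprime (2 : ℤ) p :=
    Nat.isCoprime_iff_coprime.mpr ((Nat.coprime_primes Nat.prime_two hp.out).mpr hp2.symm)
  refine hcop.symm.dvd_of_dvd_mul_left (?_ : (p : ℤ) ∣ 2 * (u' - b * v'))
  convert hres using 1
  ring

/-- The descent that replaces the reduction theory of forms of discriminant `-232`. -/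
theorem exists_norm_eq_of_small_multiple {p : ℕ} [hp : Fact p.Prime] (hp2 : p ≠ 2) {b : ℤ}
    (hb : (p : ℤ) ∣ b ^ 2 + 58) (k : ℕ) (hk0 : 0 < k) (hk : k < 29) {u v : ℤ}
    (huv : u ^ 2 + 58 * v ^ 2 = k * p) (hres : (p : ℤ) ∣ u - b * v) :
    ∃ k x y : ℤ, (k = 1 ∨ k = 2) ∧ x ^ 2 + 58 * y ^ 2 = k * p ∧ (p : ℤ) ∣ x - b * y := by
  induction k using Nat.strong_induction_on generalizing u v with
  | _ k ih =>
  have descend : ∀ l : ℕ, l.Prime → (∀ x : ZMod l, x ^ 2 ≠ -58) → l ∣ k →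
      ∃ k x y : ℤ, (k = 1 ∨ k = 2) ∧ x ^ 2 + 58 * y ^ 2 = k * p ∧ (p : ℤ) ∣ x - b * y := by
    intro l hl h hlk
    have : Fact l.Prime := ⟨hl⟩
    obtain ⟨k', u', v', hkk, h1, h2⟩ := exists_smaller_multiple h hb huv hres hlk
    have hl2 := hl.two_le
    have hk' : 0 < k' := Nat.pos_of_ne_zero (by rintro rfl; omega)
    have hlt : k' < k := by rw [hkk]; nlinarith [Nat.mul_le_mul hl2 hl2]
    exact ih k' hlt hk' (hlt.trans hk) h1 h2
  have cases : k = 1 ∨ k = 2 ∨ 4 ∣ k ∨ 3 ∣ k ∨ 5 ∣ k ∨ 7 ∣ k ∨ 11 ∣ k ∨ 13 ∣ k ∨ 17 ∣ k ∨ 19 ∣ k ∨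
      23 ∣ k := by interval_cases k <;> decide
  rcases cases with rfl | rfl | h | h | h | h | h | h | h | h | h
  · exact ⟨1, u, v, Or.inl rfl, by simpa using huv, hres⟩
  · exact ⟨2, u, v, Or.inr rfl, by simpa using huv, hres⟩
  · obtain ⟨k', rfl⟩ := h
    obtain ⟨u', v', h1, h2⟩ := exists_smaller_multiple_four hp2 huv hres
    exact ih k' (by omega) (by omega) (by omega) h1 h2
  · exact descend 3 (by norm_num) (by decide) h
  · exact descend 5 (by norm_num) (by decide) h
  · exact descend 7 (by norm_num) (by decide) h
  · exact descend 11 (by norm_num) (by decide) h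
  · exact descend 13 (by norm_num) (by decide) h
  · exact descend 17 (by norm_num) (by decide) h
  · exact descend 19 (by norm_num) (by decide) h
  · exact descend 23 (by norm_num) (by decide) h

theorem exists_norm_eq_of_split {p : ℕ} [hp : Fact p.Prime] (hp2 : p ≠ 2) {b : ℤ}
    (hb : (p : ℤ) ∣ b ^ 2 + 58) :
    ∃ k x y : ℤ, (k = 1 ∨ k = 2) ∧ x ^ 2 + 58 * y ^ 2 = k * p ∧ (p : ℤ) ∣ x - b * y := by
  have h3 : ∀ c : ZMod 3, c ^ 2 + 58 ≠ 0 := by decide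
  have hp3 : p ≠ 3 := by
    rintro rfl
    have := (ZMod.intCast_zmod_eq_zero_iff_dvd (b ^ 2 + 58) 3).mpr hb
    push_cast at this
    exact h3 _ this
  have hp5 : 4 ≤ p := by
    have := hp.out.two_le
    omega
  set m := Nat.sqrt p with hm
  have hm2 : 2 ≤ m := by
    rw [hm, Nat.le_sqrt]; omega
  have hmle : m * m ≤ p := Nat.sqrt_le p
  have hmlt : p < (m + 1) * (m + 1) := Nat.lt_succ_sqrt p
  obtain ⟨u, v, hne, hu, hv, hres⟩ := exists_lattice_point_le p hp.out.ne_zero b (3 * m + 2) (m / 3)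
    (by nlinarith [Nat.div_add_mod m 3, Nat.mod_lt m (by norm_num : 3 > 0)])
  have hdvd : (p : ℤ) ∣ u ^ 2 + 58 * v ^ 2 := by
    obtain ⟨c, hc⟩ := hres
    obtain ⟨e, he⟩ := hb
    exact ⟨c * (u + b * v) + e * v ^ 2, by linear_combination (u + b * v) * hc + v ^ 2 * he⟩
  obtain ⟨K, hK⟩ := hdvd
  have hppos : (0 : ℤ) < p := by exact_mod_cast hp.out.pos
  have hpos : 0 < u ^ 2 + 58 * v ^ 2 := by
    rcases hne with h | h
    · have := sq_nonneg v
      have : 0 < u ^ 2 := by positivity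
      linarith
    · have := sq_nonneg u
      have : 0 < v ^ 2 := by positivity
      linarith
  have hKpos : 0 < K := by
    rw [hK] at hpos
    exact pos_of_mul_pos_right hpos hppos.le
  have hu2 : u ^ 2 ≤ (3 * (m : ℤ) + 2) ^ 2 := by
    refine sq_le_sq.mpr ?_
    rw [abs_of_nonneg (by positivity : (0 : ℤ) ≤ 3 * (m : ℤ) + 2)]
    exact_mod_cast hu
  have hv2 : 9 * v ^ 2 ≤ (m : ℤ) ^ 2 := by
    have h1 : |3 * v| ≤ |(m : ℤ)| := by
      rw [abs_mul]
      have : ((m / 3 : ℕ) : ℤ) * 3 ≤ m := by exact_mod_cast Nat.div_mul_le_self m 3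
      simp only [Nat.abs_ofNat, Nat.abs_cast]
      linarith
    have := sq_le_sq.mpr h1
    linarith
  have hKlt : K < 29 := by
    have h1 : (m : ℤ) * m ≤ p := by exact_mod_cast hmle
    have h2 : (2 : ℤ) ≤ m := by exact_mod_cast hm2
    by_contra hcon
    push Not at hcon
    nlinarith
  lift K to ℕ using hKpos.le
  exact exists_norm_eq_of_small_multiple hp2 hb K (by exact_mod_cast hKpos) (by exact_mod_cast hKlt)
    (by rw [hK]; ring) hres

instance fact_prime_twentyNine : Fact (Nat.Prime 29) := ⟨by norm_num⟩

/-- The difference between the numbers of representations of `n` by `x² + 58 y²` and by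
`2 x² + 29 y²`. -/
noncomputable def repDiff (n : ℕ) : ℤ := repCount n - repCount (2 * n)

theorem repDiff_one : repDiff 1 = 2 := by
  have h1 : normFiber 1 = {(1, 0), (-1, 0)} := by
    ext ⟨u, v⟩
    simp only [normFiber, Set.mem_ofPred_eq, Set.mem_insert_iff, Set.mem_singleton_iff,
      Prod.mk.injEq]
    constructor
    · intro h
      have hv : v = 0 := by
        by_contra hv
        have : 0 < v ^ 2 := by positivity
        nlinarith [sq_nonneg u]
      subst hv
      have : u ^ 2 = 1 := by linarith
      have hmul : (u - 1) * (u + 1) = 0 := by linarith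
      rcases mul_eq_zero.mp hmul with h | h
      · exact Or.inl ⟨by linarith, rfl⟩
      · exact Or.inr ⟨by linarith, rfl⟩
    · rintro (⟨rfl, rfl⟩ | ⟨rfl, rfl⟩) <;> norm_num
  have h2 : normFiber 2 = ∅ := by
    ext ⟨u, v⟩
    simp only [normFiber, Set.mem_ofPred_eq, Set.mem_empty_iff_false, iff_false]
    intro h
    have hv : v = 0 := by
      by_contra hv
      have : 0 < v ^ 2 := by positivity
      nlinarith [sq_nonneg u]
    subst hv
    obtain ⟨w, rfl⟩ := (even_of_sq_add_mul_sq (n := 1) h).two_dvd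
    have : 2 * w ^ 2 = 1 := by linarith
    omega
  have h3 : ({(1, 0), (-1, 0)} : Set (ℤ × ℤ)).ncard = 2 := Set.ncard_pair (by simp)
  simp [repDiff, repCount, h1, h2, h3]

theorem repDiff_mul_inert {p : ℕ} [hp : Fact p.Prime] (hp2 : p ≠ 2)
    (h : ∀ x : ZMod p, x ^ 2 ≠ -58) (n : ℕ) :
    repDiff (p * n) = if p ∣ n then repDiff (n / p) else 0 := by
  have hp0 : (p : ℤ) ≠ 0 := by exact_mod_cast hp.out.ne_zero
  have key : ∀ m : ℤ, repCount (p * m) = if (p : ℤ) ∣ m then repCount (m / p) else 0 := by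
    intro m
    rw [← ncard_dvd_normFiber hp0, repCount]
    congr 1
    ext ⟨u, v⟩
    simp only [Set.mem_ofPred_eq, iff_self_and]
    intro huv
    exact dvd_of_dvd_sq_add_mul_sq h ⟨m, huv⟩
  have hdvd : (p : ℤ) ∣ 2 * n ↔ p ∣ n := by
    have : (p : ℤ) ∣ 2 * n ↔ p ∣ 2 * n := by exact_mod_cast Int.natCast_dvd_natCast (m := p) (n := 2 * n)
    rw [this, hp.out.dvd_mul, Nat.prime_dvd_prime_iff_eq hp.out Nat.prime_two]
    simp [hp2]
  have hn := key n
  have h2n := key (2 * n)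
  simp only [Int.natCast_dvd_natCast] at hn
  simp only [hdvd] at h2n
  have : (2 : ℤ) * (p * n : ℕ) = p * (2 * n) := by push_cast; ring
  rw [repDiff, this, Nat.cast_mul, hn, h2n]
  split_ifs with hpn
  · obtain ⟨m, rfl⟩ := hpn
    rw [repDiff, Nat.mul_div_cancel_left _ hp.out.pos]
    push_cast
    rw [Int.mul_ediv_cancel_left _ hp0, show (2 : ℤ) * (p * m) = p * (2 * m) by ring,
      Int.mul_ediv_cancel_left _ hp0]
  · simp

theorem repDiff_mul_split {p : ℕ} [hp : Fact p.Prime] (hp2 : p ≠ 2) (hp29 : p ≠ 29) {b x y k : ℤ}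
    (hb : (p : ℤ) ∣ b ^ 2 + 58) (hk : k = 1 ∨ k = 2) (hxy : x ^ 2 + 58 * y ^ 2 = k * p)
    (hbx : (p : ℤ) ∣ x - b * y) (n : ℕ) :
    repDiff (p * n) = 2 * (3 - 2 * k) * repDiff n - if p ∣ n then repDiff (n / p) else 0 := by
  have hp0 : (p : ℤ) ≠ 0 := by exact_mod_cast hp.out.ne_zero
  have hpp : Prime (p : ℤ) := Nat.prime_iff_prime_int.mp hp.out
  have hdvd2 : ¬ (p : ℤ) ∣ 2 := by
    intro h
    exact hp2 ((Nat.prime_dvd_prime_iff_eq hp.out Nat.prime_two).mp (by exact_mod_cast h))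
  have hdvd58 : ¬ (p : ℤ) ∣ 58 := by
    intro h
    rcases hpp.dvd_or_dvd (show (p : ℤ) ∣ 2 * 29 by norm_num [h]) with h | h
    · exact hdvd2 h
    · exact hp29 ((Nat.prime_dvd_prime_iff_eq hp.out (by norm_num)).mp (by exact_mod_cast h))
  have key := repCount_prime_mul hpp hdvd2 hdvd58 hb hk hxy hbx
  have hdvd : (p : ℤ) ∣ 2 * n ↔ p ∣ n := by
    rw [hpp.dvd_mul, Int.natCast_dvd_natCast]
    simp [hdvd2]
  have hn := key n
  have h2n := key (2 * n)
  simp only [Int.natCast_dvd_natCast] at hn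
  simp only [hdvd] at h2n
  have h3 : (2 : ℤ) * (p * n : ℕ) = p * (2 * n) := by push_cast; ring
  have hkk : 2 * ((repCount (k * n) : ℤ) - repCount (k * (2 * n))) = 2 * (3 - 2 * k) * repDiff n := by
    rcases hk with rfl | rfl
    · simp [repDiff]
    · rw [show (2 : ℤ) * (2 * n) = 4 * n by ring, repCount_four_mul, repDiff]
      ring
  rw [repDiff, h3, Nat.cast_mul, ← hkk]
  split_ifs at hn h2n ⊢ with hpn
  · obtain ⟨m, rfl⟩ := hpn
    rw [repDiff, Nat.mul_div_cancel_left _ hp.out.pos]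
    push_cast at hn h2n ⊢
    rw [Int.mul_ediv_cancel_left _ hp0] at hn
    rw [show (2 : ℤ) * (p * m) = p * (2 * m) by ring, Int.mul_ediv_cancel_left _ hp0] at h2n
    rw [show (2 : ℤ) * (p * m) = p * (2 * m) by ring]
    omega
  · omega

theorem quadraticChar_twentyNine_zero : quadraticChar (ZMod 29) 0 = 0 := by decide

/-- The Euler factor of `repDiff` at `p`. -/
theorem repDiff_prime_mul {p : ℕ} (hp : p.Prime) (n : ℕ) :
    repDiff (p * n) = (ZMod.χ₈' p + quadraticChar (ZMod 29) p) * repDiff n -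
      ZMod.χ₈' p * quadraticChar (ZMod 29) p * if p ∣ n then repDiff (n / p) else 0 := by
  rcases eq_or_ne p 2 with rfl | hp2
  · have h1 : ZMod.χ₈' ((2 : ℕ) : ZMod 8) = 0 := by decide
    have h2 : quadraticChar (ZMod 29) ((2 : ℕ) : ZMod 29) = -1 := by decide
    rw [h1, h2, repDiff, repDiff]
    push_cast
    rw [← mul_assoc, show (2 : ℤ) * 2 = 4 by norm_num, repCount_four_mul]
    ring
  rcases eq_or_ne p 29 with rfl | hp29
  · have h1 : ZMod.χ₈' ((29 : ℕ) : ZMod 8) = -1 := by decide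
    have h2 : quadraticChar (ZMod 29) ((29 : ℕ) : ZMod 29) = 0 := quadraticChar_twentyNine_zero
    rw [h1, h2, repDiff, repDiff]
    push_cast
    rw [show (2 : ℤ) * (29 * n) = 29 * (2 * n) by ring, repCount_mul_twentyNine,
      repCount_mul_twentyNine, ← mul_assoc, show (2 : ℤ) * 2 = 4 by norm_num, repCount_four_mul]
    ring
  have : Fact p.Prime := ⟨hp⟩
  have hleg : legendreSym p (-58) = ZMod.χ₈' p * quadraticChar (ZMod 29) p := by
    rw [show (-58 : ℤ) = -2 * (29 : ℕ) by norm_num, legendreSym.mul, legendreSym.at_neg_two hp2,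
      legendreSym.quadratic_reciprocity_one_mod_four (by norm_num) hp2]
    simp [legendreSym]
  have h29 : ((p : ℤ) : ZMod 29) ≠ 0 := by
    rw [Int.cast_natCast, Ne, ZMod.natCast_eq_zero_iff, Nat.prime_dvd_prime_iff_eq (by norm_num) hp]
    exact hp29.symm
  have hsq29 : quadraticChar (ZMod 29) p * quadraticChar (ZMod 29) p = 1 := by
    have := quadraticChar_sq_one h29
    rw [Int.cast_natCast] at this
    linarith
  have h58 : ((-58 : ℤ) : ZMod p) ≠ 0 := by
    rw [Ne, ZMod.intCast_zmod_eq_zero_iff_dvd]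
    rw [dvd_neg]
    intro h
    have h' : p ∣ 2 * 29 := by exact_mod_cast h
    rcases hp.dvd_mul.mp h' with h | h
    · exact hp2 ((Nat.prime_dvd_prime_iff_eq hp Nat.prime_two).mp h)
    · exact hp29 ((Nat.prime_dvd_prime_iff_eq hp (by norm_num)).mp h)
  rcases legendreSym.eq_one_or_neg_one p h58 with hsp | hin
  · obtain ⟨c, hc⟩ := (legendreSym.eq_one_iff p h58).mp hsp
    obtain ⟨b, rfl⟩ := ZMod.intCast_surjective c
    have hb : (p : ℤ) ∣ b ^ 2 + 58 := by
      rw [← ZMod.intCast_zmod_eq_zero_iff_dvd]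
      push_cast at hc ⊢
      linear_combination -hc
    obtain ⟨k, x, y, hk, hxy, hbx⟩ := exists_norm_eq_of_split hp2 hb
    have hchar : quadraticChar (ZMod 29) p = 3 - 2 * k := by
      have hx : quadraticChar (ZMod 29) ((k : ZMod 29) * p) = 1 := by
        have hcast : (x : ZMod 29) ^ 2 = k * p := by
          have := congrArg (Int.cast : ℤ → ZMod 29) hxy
          push_cast at this
          have h0 : (58 : ZMod 29) = 0 := by decide
          rw [h0] at this
          simpa using this
        have hk29 : (k : ZMod 29) ≠ 0 := by
          rcases hk with rfl | rfl <;> decide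
        rw [← hcast]
        refine quadraticChar_sq_one' ?_
        intro hx0
        rw [hx0] at hcast
        refine mul_ne_zero hk29 h29 ?_
        simpa using hcast.symm
      rw [map_mul] at hx
      rcases hk with rfl | rfl
      · simpa using hx
      · have h2 : quadraticChar (ZMod 29) ((2 : ℤ) : ZMod 29) = -1 := by decide
        rw [h2] at hx
        linarith
    have hchar8 : ZMod.χ₈' p = 3 - 2 * k := by
      rw [← hchar]
      have := congrArg (· * quadraticChar (ZMod 29) p) (hsp.symm.trans hleg)
      simp only [mul_assoc, hsq29] at this
      linarith
    rw [repDiff_mul_split hp2 hp29 hb hk hxy hbx, hchar, hchar8]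
    have : (3 - 2 * k) * (3 - 2 * k) = 1 := by rcases hk with rfl | rfl <;> norm_num
    rw [this]
    ring
  · have hno : ∀ x : ZMod p, x ^ 2 ≠ -58 := by
      intro x hx
      rw [legendreSym.eq_neg_one_iff] at hin
      exact hin ⟨x, by push_cast; rw [← hx]; ring⟩
    have hsum : ZMod.χ₈' p + quadraticChar (ZMod 29) p = 0 := by
      have := congrArg (· * quadraticChar (ZMod 29) p) (hin.symm.trans hleg)
      simp only [mul_assoc, hsq29] at this
      linarith
    rw [repDiff_mul_inert hp2 hno, hsum, ← hleg, hin]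
    ring

/-- A character modulo `N` as an arithmetic function. -/
def charArith {N : ℕ} (χ : MulChar (ZMod N) ℤ) (h : χ 0 = 0) : ArithmeticFunction ℤ :=
  ⟨fun n => χ n, by simpa using h⟩

theorem charArith_isMultiplicative {N : ℕ} (χ : MulChar (ZMod N) ℤ) (h : χ 0 = 0) :
    (charArith χ h).IsMultiplicative :=
  ⟨by simp [charArith], fun _ => by simp [charArith]⟩

theorem chi8'_zero : ZMod.χ₈' 0 = 0 := by decide

/-- The convolution of the quadratic characters of conductors `-8` and `29`. -/
def genusConv : ArithmeticFunction ℤ :=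
  charArith ZMod.χ₈' chi8'_zero * charArith (quadraticChar (ZMod 29)) quadraticChar_twentyNine_zero

theorem genusConv_prime_pow {p : ℕ} (hp : p.Prime) (k : ℕ) :
    genusConv (p ^ k) = ∑ i ∈ Finset.range (k + 1),
      ZMod.χ₈' p ^ i * quadraticChar (ZMod 29) p ^ (k - i) := by
  rw [genusConv, ArithmeticFunction.mul_apply,
    Nat.sum_divisorsAntidiagonal (f := fun a b => (charArith ZMod.χ₈' chi8'_zero) a *
      (charArith (quadraticChar (ZMod 29)) quadraticChar_twentyNine_zero) b),
    Nat.sum_divisors_prime_pow hp]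
  refine Finset.sum_congr rfl fun i hi => ?_
  rw [Nat.pow_div (by simpa [Nat.lt_succ_iff] using hi) hp.pos]
  simp only [charArith, ArithmeticFunction.coe_mk, Nat.cast_pow, map_pow]

theorem genusConv_prime_pow_succ {p : ℕ} (hp : p.Prime) (k : ℕ) :
    genusConv (p ^ (k + 1)) = quadraticChar (ZMod 29) p * genusConv (p ^ k) +
      ZMod.χ₈' p ^ (k + 1) := by
  rw [genusConv_prime_pow hp, genusConv_prime_pow hp, Finset.sum_range_succ, Finset.mul_sum]
  congr 1
  · refine Finset.sum_congr rfl fun i hi => ?_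
    have : k + 1 - i = (k - i) + 1 := by
      have := Finset.mem_range.mp hi
      omega
    rw [this, pow_succ]
    ring
  · simp

theorem genusConv_isMultiplicative : genusConv.IsMultiplicative :=
  (charArith_isMultiplicative _ _).mul (charArith_isMultiplicative _ _)

theorem repDiff_prime_pow_mul {p m : ℕ} (hp : p.Prime) (hm : ¬ p ∣ m) (k : ℕ) :
    repDiff (p ^ k * m) = genusConv (p ^ k) * repDiff m := by
  induction k using Nat.twoStepInduction with
  | zero => rw [pow_zero, genusConv_isMultiplicative.map_one, one_mul, one_mul]
  | one =>
    rw [pow_one, repDiff_prime_mul hp, if_neg hm]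
    have := genusConv_prime_pow_succ hp 0
    simp only [zero_add, pow_one, pow_zero] at this
    rw [this, genusConv_isMultiplicative.map_one]
    ring
  | more k ih1 ih2 =>
    have hdiv : p ^ (k + 1) * m / p = p ^ k * m := by
      rw [show p ^ (k + 1) * m = p * (p ^ k * m) by ring, Nat.mul_div_cancel_left _ hp.pos]
    rw [show p ^ (k + 2) * m = p * (p ^ (k + 1) * m) by ring, repDiff_prime_mul hp, ih2,
      if_pos (Dvd.dvd.mul_right (dvd_pow_self p k.succ_ne_zero) m), hdiv, ih1]
    have h1 := genusConv_prime_pow_succ hp k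
    have h2 := genusConv_prime_pow_succ hp (k + 1)
    linear_combination ZMod.χ₈' p * repDiff m * h1 - repDiff m * h2

theorem repDiff_eq_genusConv {n : ℕ} (hn : n ≠ 0) : repDiff n = 2 * genusConv n := by
  induction n using Nat.strong_induction_on with
  | _ n ih =>
  rcases eq_or_ne n 1 with rfl | hn1
  · rw [repDiff_one, genusConv_isMultiplicative.map_one, mul_one]
  have hp := Nat.minFac_prime hn1
  obtain ⟨k, m, hm, hnm⟩ := Nat.exists_eq_pow_mul_and_not_dvd hn n.minFac hp.ne_one
  have hk : k ≠ 0 := by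
    rintro rfl
    rw [pow_zero, one_mul] at hnm
    exact hm (hnm ▸ n.minFac_dvd)
  have hm0 : m ≠ 0 := by
    rintro rfl
    exact hm (dvd_zero _)
  have hlt : m < n := by
    conv_rhs => rw [hnm]
    exact lt_mul_of_one_lt_left (Nat.pos_of_ne_zero hm0) (Nat.one_lt_pow hk hp.one_lt)
  have hcop : (n.minFac ^ k).Coprime m := Nat.Coprime.pow_left k ((Nat.Prime.coprime_iff_not_dvd hp).mpr hm)
  have h1 := repDiff_prime_pow_mul hp hm k
  have h2 := genusConv_isMultiplicative.map_mul_of_coprime hcop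
  rw [← hnm] at h1 h2
  rw [h1, h2, ih m hlt hm0]
  ring

theorem LSeries_ofReal (x : ℕ → ℝ) {s : ℝ} (hs : s ≠ 0) :
    LSeries (fun n => (x n : ℂ)) s = ((∑' n : ℕ, x n * (n : ℝ) ^ (-s) : ℝ) : ℂ) := by
  rw [LSeries, Complex.ofReal_tsum]
  refine tsum_congr fun n => ?_
  rcases eq_or_ne n 0 with rfl | hn
  · simp [Real.zero_rpow (neg_ne_zero.mpr hs)]
  · rw [LSeries.term_of_ne_zero hn, Real.rpow_neg (Nat.cast_nonneg n), Complex.ofReal_mul,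
      Complex.ofReal_inv, Complex.ofReal_cpow (Nat.cast_nonneg n), Complex.ofReal_natCast,
      div_eq_mul_inv]

/-- The Dirichlet series of an integer-valued character, for real arguments. -/
noncomputable def charL {N : ℕ} (χ : MulChar (ZMod N) ℤ) (s : ℝ) : ℝ :=
  ∑' n : ℕ, (χ n : ℝ) * (n : ℝ) ^ (-s)

theorem abs_mulChar_le_one {N : ℕ} [NeZero N] (χ : MulChar (ZMod N) ℤ) (n : ℕ) :
    |χ n| ≤ 1 := by
  by_cases hn : IsUnit (n : ZMod N)
  · obtain ⟨u, hu⟩ := hn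
    have hpow : χ n ^ Fintype.card (ZMod N)ˣ = 1 := by
      rw [← map_pow, ← hu, ← Units.val_pow_eq_pow_val, pow_card_eq_one, Units.val_one, map_one]
    exact (Int.isUnit_iff_abs_eq.mp (IsUnit.of_pow_eq_one hpow Fintype.card_ne_zero)).le
  · rw [χ.map_nonunit hn, abs_zero]
    exact zero_le_one

theorem charArith_LSeriesSummable {N : ℕ} [NeZero N] (χ : MulChar (ZMod N) ℤ) (h : χ 0 = 0) {s : ℝ}
    (hs : 1 < s) : LSeriesSummable (fun n => ((charArith χ h n : ℝ) : ℂ)) s := by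
  refine LSeriesSummable_of_bounded_of_one_lt_re (m := 1) (fun n _ => ?_) (by simpa using hs)
  rw [Complex.norm_real, Real.norm_eq_abs]
  exact_mod_cast abs_mulChar_le_one χ n

theorem tsum_repDiff_eq {s : ℝ} (hs : 1 < s) :
    ∑' n : ℕ, (repDiff n : ℝ) * (n : ℝ) ^ (-s) =
      2 * (charL ZMod.χ₈' s * charL (quadraticChar (ZMod 29)) s) := by
  have h := LSeries_convolution' (charArith_LSeriesSummable ZMod.χ₈' chi8'_zero hs)
    (charArith_LSeriesSummable (quadraticChar (ZMod 29)) quadraticChar_twentyNine_zero hs)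
  rw [LSeries_ofReal _ (by positivity), LSeries_ofReal _ (by positivity)] at h
  have hc : LSeries (LSeries.convolution
      (fun n => ((charArith ZMod.χ₈' chi8'_zero n : ℝ) : ℂ))
      (fun n => ((charArith (quadraticChar (ZMod 29)) quadraticChar_twentyNine_zero n : ℝ) : ℂ))) s =
      LSeries (fun n => ((genusConv n : ℝ) : ℂ)) s := by
    refine LSeries_congr (fun {n} hn => ?_) _
    rw [LSeries.convolution_def, genusConv, ArithmeticFunction.mul_apply]
    push_cast
    rfl
  rw [hc, LSeries_ofReal _ (by positivity)] at h
  have h' : ∑' n : ℕ, (genusConv n : ℝ) * (n : ℝ) ^ (-s) =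
      charL ZMod.χ₈' s * charL (quadraticChar (ZMod 29)) s := by exact_mod_cast h
  rw [← h', ← tsum_mul_left]
  refine tsum_congr fun n => ?_
  rcases eq_or_ne n 0 with rfl | hn
  · simp [Real.zero_rpow (show -s ≠ 0 by linarith)]
  · rw [repDiff_eq_genusConv hn]
    push_cast
    ring

/-- The Epstein zeta function of the form `a x² + b y²`. -/
noncomputable def epstein (a b s : ℝ) : ℝ :=
  ∑' z : ℤ × ℤ, (a * (z.1 : ℝ) ^ 2 + b * (z.2 : ℝ) ^ 2) ^ (-s)

theorem summable_epstein {a b s : ℝ} (ha : 1 ≤ a) (hb : 1 ≤ b) (hs : 1 < s) :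
    Summable fun z : ℤ × ℤ => (a * (z.1 : ℝ) ^ 2 + b * (z.2 : ℝ) ^ 2) ^ (-s) := by
  have h := EisensteinSeries.summable_one_div_norm_rpow (k := 2 * s) (by linarith)
  rw [← (finTwoArrowEquiv ℤ).symm.summable_iff] at h
  refine Summable.of_nonneg_of_le (fun z => by positivity) (fun z => ?_) h
  obtain ⟨u, v⟩ := z
  have hnorm : ‖(finTwoArrowEquiv ℤ).symm (u, v)‖ = max |(u : ℝ)| |(v : ℝ)| := by
    rw [EisensteinSeries.norm_eq_max_natAbs]
    simp [Nat.cast_natAbs]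
  simp only [Function.comp_apply, hnorm]
  by_cases hz : u = 0 ∧ v = 0
  · obtain ⟨rfl, rfl⟩ := hz
    simp [Real.zero_rpow (show -s ≠ 0 by linarith), Real.zero_rpow (show -(2 * s) ≠ 0 by linarith)]
  have hpos : 0 < max |(u : ℝ)| |(v : ℝ)| := by
    rw [lt_max_iff, abs_pos, abs_pos]
    by_contra! h
    exact hz (by exact_mod_cast h)
  rw [show -(2 * s) = 2 * (-s) by ring, Real.rpow_mul hpos.le]
  refine Real.rpow_le_rpow_of_nonpos (by positivity) ?_ (by linarith)
  rw [Real.rpow_two]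
  rcases max_choice |(u : ℝ)| |(v : ℝ)| with h | h <;> rw [h, sq_abs] <;>
    nlinarith [sq_nonneg (u : ℝ), sq_nonneg (v : ℝ)]

theorem tsum_fiber_eq {Q : ℤ × ℤ → ℕ} {s : ℝ} (hQ : Summable fun z => (Q z : ℝ) ^ (-s)) :
    HasSum (fun n : ℕ => (Set.ncard {z | Q z = n} : ℝ) * (n : ℝ) ^ (-s))
      (∑' z, (Q z : ℝ) ^ (-s)) := by
  have hfib : ∀ n : ℕ, ∑' z : Q ⁻¹' {n}, (Q z : ℝ) ^ (-s) =
      (Set.ncard {z | Q z = n} : ℝ) * (n : ℝ) ^ (-s) := fun n => by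
    have : ∀ z : Q ⁻¹' {n}, (Q z : ℝ) ^ (-s) = (n : ℝ) ^ (-s) := fun z => by
      rw [show Q z = n from z.2]
    rw [tsum_congr this, tsum_const, nsmul_eq_mul]
    rfl
  exact (funext hfib : _ = _) ▸ hQ.hasSum.tsum_fiberwise Q

theorem tsum_repDiff_eq_epstein {s : ℝ} (hs : 1 < s) :
    ∑' n : ℕ, (repDiff n : ℝ) * (n : ℝ) ^ (-s) = epstein 1 58 s - 2 ^ s * epstein 4 58 s := by
  have hT := summable_epstein (a := 1) (b := 58) le_rfl (by norm_num) hs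
  have hE := summable_epstein (a := 2) (b := 29) (by norm_num) (by norm_num) hs
  have h1 : ∀ z : ℤ × ℤ, ((z.1 ^ 2 + 58 * z.2 ^ 2).toNat : ℝ) =
      1 * (z.1 : ℝ) ^ 2 + 58 * (z.2 : ℝ) ^ 2 := fun z => by
    have : ((z.1 ^ 2 + 58 * z.2 ^ 2).toNat : ℤ) = z.1 ^ 2 + 58 * z.2 ^ 2 :=
      Int.toNat_of_nonneg (by positivity)
    have := congrArg (Int.cast : ℤ → ℝ) this
    push_cast at this
    rw [this, one_mul]
  have h2 : ∀ z : ℤ × ℤ, ((2 * z.1 ^ 2 + 29 * z.2 ^ 2).toNat : ℝ) =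
      2 * (z.1 : ℝ) ^ 2 + 29 * (z.2 : ℝ) ^ 2 := fun z => by
    have : ((2 * z.1 ^ 2 + 29 * z.2 ^ 2).toNat : ℤ) = 2 * z.1 ^ 2 + 29 * z.2 ^ 2 :=
      Int.toNat_of_nonneg (by positivity)
    have := congrArg (Int.cast : ℤ → ℝ) this
    push_cast at this
    rw [this]
  simp only [← h1] at hT
  simp only [← h2] at hE
  have hc1 : ∀ n : ℕ, Set.ncard {z : ℤ × ℤ | (z.1 ^ 2 + 58 * z.2 ^ 2).toNat = n} =
      repCount n := fun n => by
    rw [repCount, normFiber]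
    congr 1
    ext z
    have : 0 ≤ z.1 ^ 2 + 58 * z.2 ^ 2 := by positivity
    simp only [Set.mem_ofPred_eq]
    omega
  have hc2 : ∀ n : ℕ, Set.ncard {z : ℤ × ℤ | (2 * z.1 ^ 2 + 29 * z.2 ^ 2).toNat = n} =
      repCount (2 * n) := fun n => by
    have himg : normFiber (2 * n) = (fun z : ℤ × ℤ => (2 * z.1, z.2)) ''
        {z : ℤ × ℤ | (2 * z.1 ^ 2 + 29 * z.2 ^ 2).toNat = n} := by
      ext ⟨u, v⟩
      simp only [normFiber, Set.mem_ofPred_eq, Set.mem_image, Prod.mk.injEq, Prod.exists]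
      constructor
      · intro h
        obtain ⟨x, rfl⟩ := (even_of_sq_add_mul_sq h).two_dvd
        refine ⟨x, v, ?_, rfl, rfl⟩
        have : 2 * x ^ 2 + 29 * v ^ 2 = n := by linarith
        omega
      · rintro ⟨x, v, h, rfl, rfl⟩
        have : 0 ≤ 2 * x ^ 2 + 29 * v ^ 2 := by positivity
        have : 2 * x ^ 2 + 29 * v ^ 2 = n := by omega
        linarith
    rw [repCount, himg, Set.ncard_image_of_injective]
    rintro ⟨a, b⟩ ⟨c, d⟩ h
    simp only [Prod.mk.injEq] at h ⊢
    omega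
  have hsT := tsum_fiber_eq hT
  have hsE := tsum_fiber_eq hE
  simp only [hc1, h1] at hsT
  simp only [hc2, h2] at hsE
  have hE4 : ∑' z : ℤ × ℤ, (2 * (z.1 : ℝ) ^ 2 + 29 * (z.2 : ℝ) ^ 2) ^ (-s) =
      2 ^ s * epstein 4 58 s := by
    rw [epstein, ← tsum_mul_left]
    refine tsum_congr fun z => ?_
    rw [show 4 * (z.1 : ℝ) ^ 2 + 58 * (z.2 : ℝ) ^ 2 = 2 * (2 * (z.1 : ℝ) ^ 2 + 29 * (z.2 : ℝ) ^ 2)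
      by ring, Real.mul_rpow (by norm_num) (by positivity), ← mul_assoc,
      ← Real.rpow_add (by norm_num)]
    simp
  rw [hE4] at hsE
  rw [epstein, ← (hsT.sub hsE).tsum_eq]
  refine tsum_congr fun n => ?_
  rw [repDiff]
  push_cast
  ring

theorem tsum_int_of_even {f : ℤ → ℝ} (hf : f.Even) (hs : Summable f) :
    ∑' n, f n = f 0 + 2 * ∑' n : ℕ, f (n + 1) := by
  rw [tsum_int_eq_zero_add_two_mul_tsum_pnat hf hs, nsmul_eq_mul,
    tsum_pnat_eq_tsum_succ (f := fun n : ℕ => f n)]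
  push_cast
  rfl

/-- Sums of an antitone sequence over the even and over the odd indices differ by at most its
first term. -/
theorem tsum_even_sub_tsum_odd_mem_Icc {g : ℕ → ℝ} (hg : Antitone g) (hs : Summable g) :
    ∑' n, g (2 * n) - ∑' n, g (2 * n + 1) ∈ Set.Icc 0 (g 0) := by
  have h0 : Summable fun n => g (2 * n) := hs.comp_injective fun a b h => by simpa using h
  have h1 : Summable fun n => g (2 * n + 1) := hs.comp_injective fun a b h => by simpa using h
  have hle : ∑' n, g (2 * n + 1) ≤ ∑' n, g (2 * n) := h1.tsum_le_tsum (fun n => hg (by omega)) h0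
  have hle' : ∑' n, g (2 * (n + 1)) ≤ ∑' n, g (2 * n + 1) :=
    ((summable_nat_add_iff 1).mpr h0).tsum_le_tsum (fun n => hg (by omega)) h1
  have heq := h0.tsum_eq_zero_add
  constructor
  · linarith
  · rw [mul_zero] at heq
    linarith

theorem summable_row {a c s : ℝ} (ha : 1 ≤ a) (hc : 0 ≤ c) (hs : 1 ≤ s) :
    Summable fun x : ℤ => (a * (x : ℝ) ^ 2 + c) ^ (-s) := by
  have h := (Real.summable_abs_int_rpow (b := 2 * s) (by linarith)).add
    (hasSum_ite_eq (0 : ℤ) (c ^ (-s))).summable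
  refine Summable.of_nonneg_of_le (fun x => by positivity) (fun x => ?_) h
  rcases eq_or_ne x 0 with rfl | hx
  · simp only [Int.cast_zero, if_true]
    rw [show a * (0 : ℝ) ^ 2 + c = c by ring]
    have : 0 ≤ |(0 : ℝ)| ^ (-(2 * s)) := by positivity
    linarith
  · have hpos : 0 < |(x : ℝ)| := by positivity
    rw [if_neg hx, add_zero, show -(2 * s) = 2 * (-s) by ring, Real.rpow_mul hpos.le]
    refine Real.rpow_le_rpow_of_nonpos (by positivity) ?_ (by linarith)
    rw [Real.rpow_two, sq_abs]
    nlinarith [sq_nonneg (x : ℝ)]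

/-- The alternating sum of `(x² + c)^(-s)` over the integers. -/
noncomputable def altRow (c s : ℝ) : ℝ :=
  2 * ∑' x : ℤ, (4 * (x : ℝ) ^ 2 + c) ^ (-s) - ∑' x : ℤ, (1 * (x : ℝ) ^ 2 + c) ^ (-s)

theorem abs_altRow_le {c s : ℝ} (hc : 0 ≤ c) (hs : 1 ≤ s) :
    |altRow c s| ≤ c ^ (-s) + 2 * (1 + c) ^ (-s) := by
  have h4 := summable_row (a := 4) (by norm_num) hc hs
  have h1 := summable_row (a := 1) le_rfl hc hs
  have e4 := tsum_int_of_even (f := fun x : ℤ => (4 * (x : ℝ) ^ 2 + c) ^ (-s))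
    (fun x => by simp) h4
  have e1 := tsum_int_of_even (f := fun x : ℤ => (1 * (x : ℝ) ^ 2 + c) ^ (-s))
    (fun x => by simp) h1
  set g : ℕ → ℝ := fun n => (((n : ℝ) + 1) ^ 2 + c) ^ (-s) with hg
  have hga : Antitone g := fun m n hmn => by
    refine Real.rpow_le_rpow_of_nonpos (by positivity) ?_ (by linarith)
    gcongr
  have hgs : Summable g := by
    refine (h1.comp_injective (i := fun n : ℕ => (n + 1 : ℤ)) fun a b h => by simpa using h).congr
      fun n => ?_
    simp [hg]
  have hodd := hgs.comp_injective (i := fun n => 2 * n + 1) fun a b h => by simpa using h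
  have heven := hgs.comp_injective (i := fun n => 2 * n) fun a b h => by simpa using h
  have hsplit := tsum_even_add_odd heven hodd
  have hmem := tsum_even_sub_tsum_odd_mem_Icc hga hgs
  have hg1 : ∑' n : ℕ, (1 * (((n + 1 : ℤ) : ℤ) : ℝ) ^ 2 + c) ^ (-s) = ∑' n, g n :=
    tsum_congr fun n => by simp [hg]
  have hg4 : ∑' n : ℕ, (4 * (((n + 1 : ℤ) : ℤ) : ℝ) ^ 2 + c) ^ (-s) = ∑' n, g (2 * n + 1) :=
    tsum_congr fun n => by
      simp only [hg]
      congr 1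
      push_cast
      ring
  have hg0 : g 0 = (1 + c) ^ (-s) := by simp [hg]
  have hc0 : 0 ≤ c ^ (-s) := by positivity
  simp only [hg1, hg4, Int.cast_zero] at e1 e4
  rw [show (4 : ℝ) * 0 ^ 2 + c = c by ring] at e4
  rw [show (1 : ℝ) * 0 ^ 2 + c = c by ring] at e1
  rw [hg0, Set.mem_Icc] at hmem
  rw [altRow, e1, e4, abs_le]
  constructor <;> linarith [hmem.1, hmem.2]

theorem rpow_neg_le_rpow_neg_one {b s : ℝ} (hb : b = 0 ∨ 1 ≤ b) (hs : 1 ≤ s) :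
    b ^ (-s) ≤ b ^ (-1 : ℝ) := by
  rcases hb with rfl | hb
  · rw [Real.zero_rpow (by linarith), Real.zero_rpow (by norm_num)]
  · exact Real.rpow_le_rpow_of_exponent_le hb (by linarith)

theorem tendsto_rpow_neg_nhds_one {b : ℝ} :
    Tendsto (fun s : ℝ => b ^ (-s)) (nhdsWithin 1 (Set.Ioi 1)) (nhds (b ^ (-1 : ℝ))) := by
  rcases eq_or_ne b 0 with rfl | hb
  · rw [Real.zero_rpow (by norm_num)]
    refine tendsto_const_nhds.congr' ?_
    filter_upwards [self_mem_nhdsWithin] with s hs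
    rw [Real.zero_rpow (by linarith [Set.mem_Ioi.mp hs])]
  · exact ((Real.continuous_const_rpow hb).comp continuous_neg).continuousAt.tendsto.mono_left
      nhdsWithin_le_nhds

theorem tendsto_row {a c : ℝ} (ha : 1 ≤ a) (hc : c = 0 ∨ 1 ≤ c) :
    Tendsto (fun s : ℝ => ∑' x : ℤ, (a * (x : ℝ) ^ 2 + c) ^ (-s)) (nhdsWithin 1 (Set.Ioi 1))
      (nhds (∑' x : ℤ, (a * (x : ℝ) ^ 2 + c) ^ (-1 : ℝ))) := by
  have hc0 : 0 ≤ c := by rcases hc with rfl | hc <;> linarith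
  refine tendsto_tsum_of_dominated_convergence (summable_row ha hc0 le_rfl)
    (fun x => tendsto_rpow_neg_nhds_one) ?_
  filter_upwards [self_mem_nhdsWithin] with s hs x
  rw [Real.norm_of_nonneg (by positivity)]
  refine rpow_neg_le_rpow_neg_one ?_ (le_of_lt hs)
  rcases eq_or_ne x 0 with rfl | hx
  · simpa using hc
  · right
    have : 1 ≤ (x : ℝ) ^ 2 := by
      have : 0 < x ^ 2 := by positivity
      exact_mod_cast this
    nlinarith

theorem tendsto_altRow {c : ℝ} (hc : c = 0 ∨ 1 ≤ c) :
    Tendsto (altRow c) (nhdsWithin 1 (Set.Ioi 1)) (nhds (altRow c 1)) :=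
  ((tendsto_row (by norm_num) hc).const_mul 2).sub (tendsto_row le_rfl hc)

theorem epstein_eq_tsum_rows {a b s : ℝ} (ha : 1 ≤ a) (hb : 1 ≤ b) (hs : 1 < s) :
    HasSum (fun v : ℤ => ∑' x : ℤ, (a * (x : ℝ) ^ 2 + b * (v : ℝ) ^ 2) ^ (-s)) (epstein a b s) := by
  have h := summable_epstein ha hb hs
  have h' := (Equiv.prodComm ℤ ℤ).summable_iff.mpr h
  rw [epstein, ← (Equiv.prodComm ℤ ℤ).tsum_eq]
  exact h'.hasSum.prod_fiberwise fun v => (h'.prod_factor v).hasSum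

theorem tendsto_alternating_epstein :
    Tendsto (fun s : ℝ => 2 * epstein 4 58 s - epstein 1 58 s) (nhdsWithin 1 (Set.Ioi 1))
      (nhds (∑' v : ℤ, altRow (58 * (v : ℝ) ^ 2) 1)) := by
  have hv : ∀ v : ℤ, 58 * (v : ℝ) ^ 2 = 0 ∨ 1 ≤ 58 * (v : ℝ) ^ 2 := fun v => by
    rcases eq_or_ne v 0 with rfl | hv
    · simp
    · right
      have : 0 < v ^ 2 := by positivity
      have : (1 : ℝ) ≤ (v : ℝ) ^ 2 := by exact_mod_cast this
      linarith
  have key : Tendsto (fun s : ℝ => ∑' v : ℤ, altRow (58 * (v : ℝ) ^ 2) s)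
      (nhdsWithin 1 (Set.Ioi 1)) (nhds (∑' v : ℤ, altRow (58 * (v : ℝ) ^ 2) 1)) := by
    refine tendsto_tsum_of_dominated_convergence
      (bound := fun v : ℤ => (58 * (v : ℝ) ^ 2) ^ (-1 : ℝ) + 2 * (58 * (v : ℝ) ^ 2 + 1) ^ (-1 : ℝ))
      ?_ (fun v => tendsto_altRow (hv v)) ?_
    · have h0 := summable_row (a := 58) (c := 0) (by norm_num) le_rfl le_rfl
      have h1 := summable_row (a := 58) (c := 1) (by norm_num) zero_le_one le_rfl
      simp only [add_zero] at h0
      exact h0.add (h1.mul_left 2)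
    · filter_upwards [self_mem_nhdsWithin] with s hs v
      have hs : 1 < s := hs
      refine (abs_altRow_le (by positivity) hs.le).trans ?_
      rw [add_comm 1]
      have h1 := rpow_neg_le_rpow_neg_one (hv v) hs.le
      have h2 := rpow_neg_le_rpow_neg_one (b := 58 * (v : ℝ) ^ 2 + 1)
        (Or.inr (by nlinarith [sq_nonneg (v : ℝ)])) hs.le
      linarith
  refine key.congr' ?_
  filter_upwards [self_mem_nhdsWithin] with s hs
  have hs : 1 < s := hs
  exact (((epstein_eq_tsum_rows (by norm_num) (by norm_num) hs).mul_left 2).sub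
    (epstein_eq_tsum_rows le_rfl (by norm_num) hs)).tsum_eq

theorem coth_series {a : ℝ} (ha : 0 < a) :
    ∑' x : ℤ, (1 * (x : ℝ) ^ 2 + a ^ 2) ^ (-1 : ℝ) = π / a * (cosh (π * a) / sinh (π * a)) := by
  have hz : (Complex.I * a : ℂ) ∈ Complex.integerComplement := by
    rw [Complex.mem_integerComplement_iff]
    rintro ⟨n, hn⟩
    have := congrArg Complex.im hn
    simp at this
    exact ha.ne this
  have h := cot_series_rep hz
  have hcot : Complex.cot (π * (Complex.I * a)) =
      -Complex.I * ((cosh (π * a) / sinh (π * a) : ℝ) : ℂ) := by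
    rw [show (π * (Complex.I * a) : ℂ) = (π * a : ℝ) * Complex.I by push_cast; ring, Complex.cot,
      Complex.cos_mul_I, Complex.sin_mul_I, Complex.ofReal_div, Complex.ofReal_cosh,
      Complex.ofReal_sinh]
    have : Complex.sinh ((π * a : ℝ) : ℂ) ≠ 0 := by
      rw [← Complex.ofReal_sinh]
      exact_mod_cast (Real.sinh_pos_iff.mpr (by positivity)).ne'
    field_simp
    rw [Complex.I_sq]
    ring
  have hterm : ∀ n : ℕ+, (1 / (Complex.I * a - n) + 1 / (Complex.I * a + n) : ℂ) =
      -(2 * a * Complex.I) * (((1 * ((n : ℕ) : ℝ) ^ 2 + a ^ 2) ^ (-1 : ℝ) : ℝ) : ℂ) := fun n => by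
    rw [Real.rpow_neg_one]
    have hn : (0 : ℝ) < (n : ℕ) := by exact_mod_cast n.pos
    have h1 : (Complex.I * a - n : ℂ) ≠ 0 := fun h => by
      have := congrArg Complex.im h
      simp at this
      exact ha.ne' this
    have h2 : (Complex.I * a + n : ℂ) ≠ 0 := fun h => by
      have := congrArg Complex.im h
      simp at this
      exact ha.ne' this
    have h3 : ((n : ℕ) ^ 2 + a ^ 2 : ℂ) ≠ 0 := by
      have : (((n : ℕ) : ℝ) ^ 2 + a ^ 2) ≠ 0 := by positivity
      exact_mod_cast this
    push_cast
    rw [one_mul]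
    field_simp
    ring_nf
    simp only [Complex.I_pow_three]
    ring
  have hsum := summable_row (a := 1) (c := a ^ 2) le_rfl (by positivity) le_rfl
  rw [tsum_int_eq_zero_add_two_mul_tsum_pnat (fun x => by simp) hsum]
  rw [hcot, tsum_congr hterm, tsum_mul_left, ← Complex.ofReal_tsum] at h
  have hI : (1 / (Complex.I * a) : ℂ) = -Complex.I * ((1 / a : ℝ) : ℂ) := by
    have : (a : ℂ) ≠ 0 := by exact_mod_cast ha.ne'
    push_cast
    field_simp
    simp
  rw [hI] at h
  have h' : π * (cosh (π * a) / sinh (π * a)) =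
      1 / a + 2 * a * ∑' n : ℕ+, (1 * ((n : ℕ) : ℝ) ^ 2 + a ^ 2) ^ (-1 : ℝ) := by
    generalize cosh (π * a) / sinh (π * a) = X at h ⊢
    generalize ∑' n : ℕ+, (1 * ((n : ℕ) : ℝ) ^ 2 + a ^ 2) ^ (-1 : ℝ) = Y at h ⊢
    have := congrArg Complex.im h
    simp at this
    rw [one_div]
    linarith
  simp only [Int.cast_zero, Int.cast_natCast, nsmul_eq_mul]
  rw [div_mul_eq_mul_div, h', show 1 * (0 : ℝ) ^ 2 + a ^ 2 = a ^ 2 by ring, Real.rpow_neg_one]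
  field_simp
  ring

theorem altRow_sq_one {a : ℝ} (ha : 0 < a) : altRow (a ^ 2) 1 = π / (a * sinh (π * a)) := by
  have h4 : ∑' x : ℤ, (4 * (x : ℝ) ^ 2 + a ^ 2) ^ (-1 : ℝ) =
      1 / 4 * ∑' x : ℤ, (1 * (x : ℝ) ^ 2 + (a / 2) ^ 2) ^ (-1 : ℝ) := by
    rw [← tsum_mul_left]
    refine tsum_congr fun x => ?_
    rw [Real.rpow_neg_one, Real.rpow_neg_one, show 4 * (x : ℝ) ^ 2 + a ^ 2 =
      4 * (1 * (x : ℝ) ^ 2 + (a / 2) ^ 2) by ring, mul_inv]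
    ring
  rw [altRow, h4, coth_series ha, coth_series (half_pos ha),
    show π * a = 2 * (π * (a / 2)) by ring, Real.sinh_two_mul, Real.cosh_two_mul]
  have hs : 0 < sinh (π * (a / 2)) := Real.sinh_pos_iff.mpr (by positivity)
  have hc : 0 < cosh (π * (a / 2)) := Real.cosh_pos _
  have hsq := Real.cosh_sq (π * (a / 2))
  generalize sinh (π * (a / 2)) = S at *
  generalize cosh (π * (a / 2)) = C at *
  field_simp
  rw [hsq]
  ring

theorem altRow_zero_one : altRow 0 1 = -(π ^ 2 / 6) := by
  have h := summable_row (a := 1) (c := 0) le_rfl le_rfl le_rfl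
  have h4 : ∑' x : ℤ, (4 * (x : ℝ) ^ 2 + 0) ^ (-1 : ℝ) =
      1 / 4 * ∑' x : ℤ, (1 * (x : ℝ) ^ 2 + 0) ^ (-1 : ℝ) := by
    rw [← tsum_mul_left]
    refine tsum_congr fun x => ?_
    rw [Real.rpow_neg_one, Real.rpow_neg_one, add_zero, add_zero, mul_inv, one_mul, one_div]
  have hz : ∑' n : ℕ, (1 : ℝ) / ((n : ℝ) + 1) ^ 2 = π ^ 2 / 6 := by
    have := hasSum_zeta_two.summable.tsum_eq_zero_add
    rw [hasSum_zeta_two.tsum_eq] at this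
    simpa using this.symm
  rw [altRow, h4, tsum_int_of_even (fun x => by simp) h]
  have : ∑' n : ℕ, (1 * (((n + 1 : ℤ) : ℤ) : ℝ) ^ 2 + 0) ^ (-1 : ℝ) = π ^ 2 / 6 := by
    rw [← hz]
    refine tsum_congr fun n => ?_
    rw [Real.rpow_neg_one]
    simp
  rw [this]
  simp
  ring

/-- Expansion of the logarithm of `∏ (1 - q ^ (2 j + 1))` as a Lambert series. -/
theorem tsum_lambert_eq {q : ℝ} (hq0 : 0 < q) (hq1 : q < 1) :
    ∑' n : ℕ, q ^ (n + 1) / (1 - q ^ (2 * (n + 1))) / (n + 1) =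
      -log (∏' j : ℕ, (1 - q ^ (2 * j + 1))) := by
  set f : ℕ → ℕ → ℝ := fun n j => (q ^ (2 * j + 1)) ^ (n + 1) / (n + 1) with hf
  have hlt : ∀ j : ℕ, q ^ (2 * j + 1) < 1 := fun j => pow_lt_one₀ hq0.le hq1 (by omega)
  have hgeom := summable_geometric_of_lt_one hq0.le hq1
  have hsum : Summable (Function.uncurry f) := by
    refine Summable.of_nonneg_of_le (fun z => ?_) (fun z => ?_)
      (hgeom.mul_of_nonneg hgeom (fun n => by positivity) fun n => by positivity)
    · simp only [Function.uncurry, hf]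
      positivity
    · obtain ⟨n, j⟩ := z
      simp only [Function.uncurry, hf]
      rw [← pow_mul, ← pow_add]
      calc q ^ ((2 * j + 1) * (n + 1)) / ((n : ℝ) + 1) ≤ q ^ ((2 * j + 1) * (n + 1)) :=
            div_le_self (by positivity) (by linarith [n.cast_nonneg (α := ℝ)])
        _ ≤ q ^ (n + j) := pow_le_pow_of_le_one hq0.le hq1.le (by nlinarith)
  have hlog : ∀ j, HasSum (fun n => f n j) (-log (1 - q ^ (2 * j + 1))) := fun j =>
    hasSum_pow_div_log_of_abs_lt_one (by rw [abs_of_pos (by positivity)]; exact hlt j)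
  have hrow : ∀ n, HasSum (fun j => f n j) (q ^ (n + 1) / (1 - q ^ (2 * (n + 1))) / (n + 1)) := by
    intro n
    have h := (hasSum_geometric_of_lt_one (r := q ^ (2 * (n + 1))) (by positivity)
      (pow_lt_one₀ hq0.le hq1 (by omega))).mul_left (q ^ (n + 1) / (n + 1))
    convert! h using 1
    · exact (funext fun j => by simp only [hf]; ring)
    · ring
  have hcomm := hsum.tsum_comm
  rw [tsum_congr fun n => (hrow n).tsum_eq, tsum_congr fun j => (hlog j).tsum_eq, tsum_neg] at hcomm
  rw [← hcomm]
  have hls : Summable fun j : ℕ => log (1 - q ^ (2 * j + 1)) := by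
    refine hsum.prod_symm.prod.neg.congr fun j => ?_
    rw [show ∑' n, Function.uncurry f (j, n).swap = _ from (hlog j).tsum_eq, neg_neg]
  rw [← Real.rexp_tsum_eq_tprod (fun j => by linarith [hlt j]) hls, Real.log_exp]

theorem tsum_altRow {q : ℝ} (hq : q = exp (-(π * √58))) :
    ∑' v : ℤ, altRow (58 * (v : ℝ) ^ 2) 1 =
      -(π ^ 2 / 6) - 4 * π / √58 * log (∏' j : ℕ, (1 - q ^ (2 * j + 1))) := by
  have hq0 : 0 < q := hq ▸ exp_pos _
  have hq1 : q < 1 := by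
    rw [hq, Real.exp_lt_one_iff]
    have : 0 < π * √58 := by positivity
    linarith
  have hs : Summable fun v : ℤ => altRow (58 * (v : ℝ) ^ 2) 1 := by
    have h0 := summable_row (a := 58) (c := 0) (by norm_num) le_rfl le_rfl
    have h1 := summable_row (a := 58) (c := 1) (by norm_num) zero_le_one le_rfl
    simp only [add_zero] at h0
    refine Summable.of_norm_bounded (h0.add (h1.mul_left 2)) fun v => ?_
    rw [add_comm (58 * (v : ℝ) ^ 2) 1]
    exact abs_altRow_le (by positivity) le_rfl
  rw [tsum_int_of_even (fun v => by simp) hs]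
  have hterm : ∀ n : ℕ, altRow (58 * (((n + 1 : ℤ) : ℤ) : ℝ) ^ 2) 1 =
      2 * π / √58 * (q ^ (n + 1) / (1 - q ^ (2 * (n + 1))) / (n + 1)) := fun n => by
    have hn : (0 : ℝ) < n + 1 := by positivity
    have h58 : (0 : ℝ) < √58 := by positivity
    rw [show 58 * (((n + 1 : ℤ) : ℤ) : ℝ) ^ 2 = (√58 * (n + 1)) ^ 2 by
      rw [mul_pow, Real.sq_sqrt (by norm_num)]; push_cast; ring, altRow_sq_one (by positivity)]
    have hexp : exp (-(π * (√58 * (n + 1)))) = q ^ (n + 1) := by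
      rw [hq, ← Real.exp_nat_mul]
      congr 1
      push_cast
      ring
    have hpos : 0 < q ^ (n + 1) := by positivity
    have hlt : q ^ (n + 1) < 1 := pow_lt_one₀ hq0.le hq1 (by omega)
    rw [Real.sinh_eq, hexp, ← neg_neg (π * (√58 * (n + 1))), Real.exp_neg (-(π * _)), hexp,
      mul_comm 2 (n + 1), pow_mul]
    generalize q ^ (n + 1) = x at *
    have h1 : 1 - x ^ 2 ≠ 0 := by nlinarith
    field_simp
  rw [tsum_congr hterm, tsum_mul_left, tsum_lambert_eq hq0 hq1]
  simp only [Int.cast_zero]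
  rw [show 58 * (0 : ℝ) ^ 2 = 0 by ring, altRow_zero_one]
  ring

theorem integrableOn_row {c s : ℝ} (hc : 1 ≤ c) (hs : 1 ≤ s) :
    MeasureTheory.IntegrableOn (fun x : ℝ => (4 * x ^ 2 + c) ^ (-s)) (Set.Ioi 0) := by
  have hpos : ∀ x : ℝ, 0 < 4 * x ^ 2 + c := fun x => by positivity
  refine MeasureTheory.Integrable.mono' (integrable_inv_one_add_sq.integrableOn) ?_ ?_
  · refine Continuous.aestronglyMeasurable ?_
    exact Continuous.rpow_const (by fun_prop) fun x => Or.inl (hpos x).ne'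
  · refine Eventually.of_forall fun x => ?_
    rw [Real.norm_of_nonneg (by have := hpos x; positivity)]
    have h1 : 1 ≤ 4 * x ^ 2 + c := by nlinarith [sq_nonneg x]
    refine (rpow_neg_le_rpow_neg_one (Or.inr h1) hs).trans ?_
    rw [Real.rpow_neg_one]
    exact inv_anti₀ (by positivity) (by nlinarith [sq_nonneg x])

theorem abs_row_sub_integral_le {c s : ℝ} (hc : 1 ≤ c) (hs : 1 ≤ s) :
    |∑' x : ℤ, (4 * (x : ℝ) ^ 2 + c) ^ (-s) - 2 * ∫ x in Set.Ioi (0 : ℝ), (4 * x ^ 2 + c) ^ (-s)| ≤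
      c ^ (-s) := by
  have hsum := summable_row (a := 4) (by norm_num) (zero_le_one.trans hc) hs
  have hpos : ∀ x : ℝ, 0 < 4 * x ^ 2 + c := fun x => by positivity
  have hanti : AntitoneOn (fun x : ℝ => (4 * x ^ 2 + c) ^ (-s)) (Set.Ici 0) := fun x hx y hy hxy => by
    have hx : 0 ≤ x := hx
    refine Real.rpow_le_rpow_of_nonpos (hpos x) ?_ (by linarith)
    gcongr
  have hnn : ∀ t ∈ Set.Ioi (0 : ℝ), 0 ≤ (4 * t ^ 2 + c) ^ (-s) := fun t _ => by
    have := hpos t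
    positivity
  have hnat : Summable fun n : ℕ => (4 * (n : ℝ) ^ 2 + c) ^ (-s) :=
    (hsum.comp_injective Nat.cast_injective).congr fun n => by simp
  have h1 := hanti.tsum_add_one_le_integral (integrableOn_row hc hs) hnn
  have h2 := hanti.integral_le_tsum hnat hnn
  rw [hnat.tsum_eq_zero_add] at h2
  rw [tsum_int_of_even (fun x => by simp) hsum]
  push_cast at *
  rw [show (4 : ℝ) * 0 ^ 2 + c = c by ring] at *
  rw [abs_le]
  constructor <;> linarith

theorem integral_row_scale {m : ℝ} (hm : 0 < m) (s : ℝ) :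
    ∫ x in Set.Ioi (0 : ℝ), (4 * x ^ 2 + 58 * m ^ 2) ^ (-s) =
      m ^ (1 - 2 * s) * ∫ x in Set.Ioi (0 : ℝ), (4 * x ^ 2 + 58) ^ (-s) := by
  have h := MeasureTheory.integral_comp_mul_left_Ioi
    (fun x : ℝ => (4 * x ^ 2 + 58 * m ^ 2) ^ (-s)) 0 hm
  rw [mul_zero, smul_eq_mul] at h
  have hcomp : ∀ x : ℝ, (4 * (m * x) ^ 2 + 58 * m ^ 2) ^ (-s) =
      m ^ (-2 * s) * (4 * x ^ 2 + 58) ^ (-s) := fun x => by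
    rw [show 4 * (m * x) ^ 2 + 58 * m ^ 2 = m ^ 2 * (4 * x ^ 2 + 58) by ring,
      Real.mul_rpow (by positivity) (by positivity), ← Real.rpow_natCast, ← Real.rpow_mul hm.le]
    congr 2
    push_cast
    ring
  simp only [hcomp] at h
  rw [MeasureTheory.integral_const_mul] at h
  rw [show 1 - 2 * s = 1 + -2 * s by ring, Real.rpow_add hm, Real.rpow_one, mul_assoc, h]
  field_simp

theorem tendsto_integral_row :
    Tendsto (fun s : ℝ => ∫ x in Set.Ioi (0 : ℝ), (4 * x ^ 2 + 58) ^ (-s))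
      (nhdsWithin 1 (Set.Ioi 1)) (nhds (π / (4 * √58))) := by
  have hval : ∫ x in Set.Ioi (0 : ℝ), (4 * x ^ 2 + 58) ^ (-1 : ℝ) = π / (4 * √58) := by
    have h58 : (0 : ℝ) < √58 := by positivity
    have h := MeasureTheory.integral_comp_mul_left_Ioi
      (fun x : ℝ => (1 + x ^ 2)⁻¹) 0 (show 0 < 2 / √58 by positivity)
    rw [mul_zero, integral_Ioi_inv_one_add_sq, arctan_zero, sub_zero, smul_eq_mul] at h
    have hcomp : ∀ x : ℝ, (4 * x ^ 2 + 58) ^ (-1 : ℝ) = 1 / 58 * (1 + (2 / √58 * x) ^ 2)⁻¹ :=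
        fun x => by
      rw [Real.rpow_neg_one, mul_pow, div_pow, Real.sq_sqrt (by norm_num)]
      field_simp
      ring
    simp only [hcomp]
    rw [MeasureTheory.integral_const_mul, h]
    have hsq : √58 ^ 2 = 58 := Real.sq_sqrt (by norm_num)
    field_simp
    rw [hsq]
    norm_num
  rw [← hval]
  refine MeasureTheory.tendsto_integral_filter_of_dominated_convergence
    (fun x : ℝ => (4 * x ^ 2 + 58) ^ (-1 : ℝ)) ?_ ?_ (integrableOn_row (by norm_num) le_rfl) ?_
  · filter_upwards [self_mem_nhdsWithin] with s hs
    exact (integrableOn_row (by norm_num) (le_of_lt hs)).aestronglyMeasurable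
  · filter_upwards [self_mem_nhdsWithin] with s hs
    refine Eventually.of_forall fun x => ?_
    rw [Real.norm_of_nonneg (by positivity)]
    exact rpow_neg_le_rpow_neg_one (Or.inr (by nlinarith [sq_nonneg x])) (le_of_lt hs)
  · exact Eventually.of_forall fun x => tendsto_rpow_neg_nhds_one

theorem tendsto_sub_mul_tsum_odd_rpow :
    Tendsto (fun s : ℝ => (s - 1) * ∑' n : ℕ, ((n : ℝ) + 1) ^ (1 - 2 * s))
      (nhdsWithin 1 (Set.Ioi 1)) (nhds (1 / 2)) := by
  have hmap : Tendsto (fun s : ℝ => 2 * s - 1) (nhdsWithin 1 (Set.Ioi 1))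
      (nhdsWithin 1 (Set.Ioi 1)) := by
    refine tendsto_nhdsWithin_iff.mpr ⟨?_, ?_⟩
    · have : Tendsto (fun s : ℝ => 2 * s - 1) (nhds 1) (nhds (2 * 1 - 1)) :=
        (continuous_const.mul continuous_id).sub continuous_const |>.tendsto 1
      rw [show (2 * 1 - 1 : ℝ) = 1 by norm_num] at this
      exact this.mono_left nhdsWithin_le_nhds
    · filter_upwards [self_mem_nhdsWithin] with s hs
      have hs : 1 < s := hs
      simp only [Set.mem_Ioi]
      linarith
  have h := (tendsto_sub_mul_tsum_nat_rpow.comp hmap).const_mul (1 / 2)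
  rw [mul_one] at h
  refine h.congr' ?_
  filter_upwards [self_mem_nhdsWithin] with s hs
  have hs : 1 < s := hs
  have hsum : Summable fun n : ℕ => 1 / (n : ℝ) ^ (2 * s - 1) :=
    Real.summable_one_div_nat_rpow.mpr (by linarith)
  simp only [Function.comp_apply]
  rw [hsum.tsum_eq_zero_add, Nat.cast_zero, Real.zero_rpow (by linarith), div_zero, zero_add,
    tsum_congr fun n : ℕ => show 1 / ((n + 1 : ℕ) : ℝ) ^ (2 * s - 1) =
      ((n : ℝ) + 1) ^ (1 - 2 * s) by
        rw [show 1 - 2 * s = -(2 * s - 1) by ring, Real.rpow_neg (by positivity)]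
        push_cast
        rw [one_div]]
  ring

/-- The residue of the Epstein zeta function of `4 x² + 58 y²` at `s = 1`. -/
theorem tendsto_sub_mul_epstein :
    Tendsto (fun s : ℝ => (s - 1) * epstein 4 58 s) (nhdsWithin 1 (Set.Ioi 1))
      (nhds (π / (2 * √58))) := by
  have hs0 : Tendsto (fun s : ℝ => s - 1) (nhdsWithin 1 (Set.Ioi 1)) (nhds 0) := by
    have : Tendsto (fun s : ℝ => s - 1) (nhds 1) (nhds (1 - 1)) :=
      (continuous_id.sub continuous_const).tendsto 1
    rw [sub_self] at this
    exact this.mono_left nhdsWithin_le_nhds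
  have hinv : Summable fun n : ℕ => (58 * ((n : ℝ) + 1) ^ 2) ^ (-1 : ℝ) := by
    have h0 := summable_row (a := 58) (c := 0) (by norm_num) le_rfl le_rfl
    refine (h0.comp_injective (i := fun n : ℕ => (n + 1 : ℤ)) fun a b h => by simpa using h).congr
      fun n => ?_
    simp
  set I : ℝ → ℝ := fun s => ∫ x in Set.Ioi (0 : ℝ), (4 * x ^ 2 + 58) ^ (-s) with hI
  set R : ℝ → ℕ → ℝ := fun s n =>
    ∑' x : ℤ, (4 * (x : ℝ) ^ 2 + 58 * ((n : ℝ) + 1) ^ 2) ^ (-s) with hR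
  have hone : ∀ n : ℕ, 1 ≤ 58 * ((n : ℝ) + 1) ^ 2 := fun n => by
    have := n.cast_nonneg (α := ℝ)
    nlinarith
  have hbound : ∀ s : ℝ, 1 < s → ∀ n : ℕ,
      ‖R s n - 2 * (((n : ℝ) + 1) ^ (1 - 2 * s) * I s)‖ ≤ (58 * ((n : ℝ) + 1) ^ 2) ^ (-1 : ℝ) := by
    intro s hs n
    rw [hI, ← integral_row_scale (by positivity)]
    exact (abs_row_sub_integral_le (hone n) hs.le).trans
      (rpow_neg_le_rpow_neg_one (Or.inr (hone n)) hs.le)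
  have hrem : Tendsto (fun s : ℝ => (s - 1) *
      ∑' n : ℕ, (R s n - 2 * (((n : ℝ) + 1) ^ (1 - 2 * s) * I s)))
      (nhdsWithin 1 (Set.Ioi 1)) (nhds 0) := by
    refine hs0.zero_mul_isBoundedUnder_le ⟨∑' n : ℕ, (58 * ((n : ℝ) + 1) ^ 2) ^ (-1 : ℝ), ?_⟩
    rw [eventually_map]
    filter_upwards [self_mem_nhdsWithin] with s hs
    exact tsum_of_norm_bounded hinv.hasSum (hbound s hs)
  have hrow0 := hs0.mul (tendsto_row (a := 4) (c := 0) (by norm_num) (Or.inl rfl))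
  have hmain := (tendsto_sub_mul_tsum_odd_rpow.mul tendsto_integral_row).const_mul 4
  have htot := (hrow0.add (hrem.const_mul 2)).add hmain
  rw [show 0 * (∑' x : ℤ, (4 * (x : ℝ) ^ 2 + 0) ^ (-1 : ℝ)) + 2 * 0 +
    4 * (1 / 2 * (π / (4 * √58))) = π / (2 * √58) by field_simp; ring] at htot
  refine htot.congr' ?_
  filter_upwards [self_mem_nhdsWithin] with s hs
  have hs : 1 < s := hs
  have hrows := epstein_eq_tsum_rows (a := 4) (b := 58) (by norm_num) (by norm_num) hs
  have heps := hrows.tsum_eq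
  rw [tsum_int_of_even (fun x => by simp) hrows.summable] at heps
  have hzs : Summable fun n : ℕ => ((n : ℝ) + 1) ^ (1 - 2 * s) := by
    have h := (summable_nat_add_iff 1).mpr
      (Real.summable_nat_rpow (p := 1 - 2 * s).mpr (by linarith))
    exact h.congr fun n => by push_cast; rfl
  have hdiff : Summable fun n => R s n - 2 * (((n : ℝ) + 1) ^ (1 - 2 * s) * I s) :=
    Summable.of_norm_bounded hinv (hbound s hs)
  have hsplit : ∑' n, R s n = ∑' n, (R s n - 2 * (((n : ℝ) + 1) ^ (1 - 2 * s) * I s)) +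
      2 * ((∑' n : ℕ, ((n : ℝ) + 1) ^ (1 - 2 * s)) * I s) := by
    rw [← tsum_mul_right, ← tsum_mul_left, ← hdiff.tsum_add ((hzs.mul_right _).mul_left 2)]
    exact tsum_congr fun n => by ring
  have hcast : ∑' n : ℕ, ∑' x : ℤ, (4 * (x : ℝ) ^ 2 + 58 * (((n + 1 : ℤ) : ℤ) : ℝ) ^ 2) ^ (-s) =
      ∑' n, R s n := tsum_congr fun n => by
    simp only [hR]
    push_cast
    rfl
  rw [hcast, hsplit] at heps
  rw [← heps]
  simp only [Int.cast_zero]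
  rw [show (58 : ℝ) * 0 ^ 2 = 0 by norm_num]
  ring

theorem tendsto_rpow_sub_mul_epstein :
    Tendsto (fun s : ℝ => (2 ^ s - 2) * epstein 4 58 s) (nhdsWithin 1 (Set.Ioi 1))
      (nhds (π * log 2 / √58)) := by
  have hd : HasDerivAt (fun s : ℝ => (2 : ℝ) ^ s) (2 ^ (1 : ℝ) * log 2) 1 := by
    simpa [mul_comm] using (hasDerivAt_id (1 : ℝ)).const_rpow (a := 2) (by norm_num)
  have hslope := hd.tendsto_slope.mono_left
    (nhdsWithin_mono 1 (show Set.Ioi (1 : ℝ) ⊆ {1}ᶜ from fun x hx => ne_of_gt hx))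
  have h := hslope.mul tendsto_sub_mul_epstein
  rw [Real.rpow_one, show 2 * log 2 * (π / (2 * √58)) = π * log 2 / √58 by field_simp] at h
  refine h.congr' ?_
  filter_upwards [self_mem_nhdsWithin] with s hs
  have hs : s - 1 ≠ 0 := by
    have : 1 < s := hs
    linarith
  rw [slope_def_field, Real.rpow_one]
  field_simp

/-- The Kronecker limit formula for the genus character. -/
theorem tendsto_tsum_repDiff {q : ℝ} (hq : q = exp (-(π * √58))) :
    Tendsto (fun s : ℝ => ∑' n : ℕ, (repDiff n : ℝ) * (n : ℝ) ^ (-s)) (nhdsWithin 1 (Set.Ioi 1))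
      (nhds (π ^ 2 / 6 + 4 * π / √58 * log (∏' j : ℕ, (1 - q ^ (2 * j + 1))) -
        π * log 2 / √58)) := by
  have h := (tendsto_alternating_epstein.add tendsto_rpow_sub_mul_epstein).neg
  rw [tsum_altRow hq] at h
  rw [show π ^ 2 / 6 + 4 * π / √58 * log (∏' j : ℕ, (1 - q ^ (2 * j + 1))) - π * log 2 / √58 =
    -(-(π ^ 2 / 6) - 4 * π / √58 * log (∏' j : ℕ, (1 - q ^ (2 * j + 1))) + π * log 2 / √58) by ring]
  refine h.congr' ?_
  filter_upwards [self_mem_nhdsWithin] with s hs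
  rw [tsum_repDiff_eq_epstein hs]
  ring

theorem abs_rpow_sub_rpow_le {s : ℝ} (h1 : 1 ≤ s) (h2 : s ≤ 2) (n : ℕ) :
    |((n : ℝ) + 1) ^ (-s) - (n : ℝ) ^ (-s)| ≤ 2 / ((n : ℝ) + 1) * (n : ℝ) ^ (-1 : ℝ) +
      if n = 0 then 1 else 0 := by
  rcases eq_or_ne n 0 with rfl | hn
  · simp [Real.zero_rpow (show -s ≠ 0 by linarith), Real.zero_rpow (show (-1 : ℝ) ≠ 0 by norm_num)]
  have hn0 : (0 : ℝ) < n := by exact_mod_cast Nat.pos_of_ne_zero hn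
  have hn1 : (1 : ℝ) ≤ n := by exact_mod_cast Nat.pos_of_ne_zero hn
  set t : ℝ := n / (n + 1) with ht
  have ht0 : 0 < t := by positivity
  have ht1 : t ≤ 1 := by rw [ht, div_le_one (by positivity)]; linarith
  have hpow : ((n : ℝ) + 1) ^ (-s) = (n : ℝ) ^ (-s) * t ^ s := by
    rw [ht, Real.div_rpow hn0.le (by positivity), Real.rpow_neg hn0.le, Real.rpow_neg (by positivity)]
    have := Real.rpow_pos_of_pos hn0 s
    field_simp
  have hts : t ^ 2 ≤ t ^ s := by
    rw [← Real.rpow_two]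
    exact Real.rpow_le_rpow_of_exponent_ge ht0 ht1 h2
  have hts1 : t ^ s ≤ 1 := Real.rpow_le_one ht0.le ht1 (by linarith)
  have hle := rpow_neg_le_rpow_neg_one (Or.inr hn1) h1
  have hnn : 0 ≤ (n : ℝ) ^ (-s) := by positivity
  have h1t : 1 - t = 1 / (n + 1) := by rw [ht]; field_simp; ring
  rw [if_neg hn, add_zero, hpow, abs_sub_comm, abs_of_nonneg (by nlinarith), mul_comm (2 / _)]
  calc (n : ℝ) ^ (-s) - (n : ℝ) ^ (-s) * t ^ s = (n : ℝ) ^ (-s) * (1 - t ^ s) := by ring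
    _ ≤ (n : ℝ) ^ (-1 : ℝ) * (2 / ((n : ℝ) + 1)) := by
      refine mul_le_mul hle ?_ (by linarith) (by positivity)
      calc 1 - t ^ s ≤ 1 - t ^ 2 := by linarith
        _ = (1 - t) * (1 + t) := by ring
        _ ≤ (1 - t) * 2 := by gcongr; linarith
        _ = 2 / ((n : ℝ) + 1) := by rw [h1t]; ring

theorem summable_rpow_sub_bound :
    Summable fun n : ℕ => 2 / ((n : ℝ) + 1) * (n : ℝ) ^ (-1 : ℝ) + if n = 0 then (1 : ℝ) else 0 := by
  refine Summable.add ?_ (hasSum_ite_eq (0 : ℕ) (1 : ℝ)).summable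
  have h := (Real.summable_one_div_nat_pow (p := 2)).mpr (by norm_num) |>.mul_left 2
  refine Summable.of_nonneg_of_le (fun n => by positivity) (fun n => ?_) h
  rcases eq_or_ne n 0 with rfl | hn
  · simp [Real.zero_rpow (show (-1 : ℝ) ≠ 0 by norm_num)]
  have hn0 : (0 : ℝ) < n := by exact_mod_cast Nat.pos_of_ne_zero hn
  rw [Real.rpow_neg_one, div_mul_eq_mul_div, ← div_eq_mul_inv, mul_one_div, div_div]
  gcongr
  nlinarith

theorem hasSum_polylog_by_parts {z : ℂ} {s : ℝ} (hs : 0 < s)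
    (h : Summable fun n : ℕ => z ^ n * ((n : ℝ) ^ (-s) : ℝ)) :
    HasSum (fun n : ℕ => z ^ (n + 1) * ((((n : ℝ) + 1) ^ (-s) - (n : ℝ) ^ (-s) : ℝ) : ℂ))
      ((1 - z) * ∑' n : ℕ, z ^ n * (((n : ℝ) ^ (-s) : ℝ) : ℂ)) := by
  have h1 := (hasSum_nat_add_iff' 1).mpr h.hasSum
  have h2 := h.hasSum.mul_left z
  convert! h1.sub h2 using 1
  · funext n
    push_cast
    ring
  · simp [Real.zero_rpow (show -s ≠ 0 by linarith)]
    ring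

theorem tsum_polylog_one_eq {z : ℂ} (hz : ‖z‖ ≤ 1) (hz1 : z ≠ 1) :
    ∑' n : ℕ, z ^ (n + 1) * ((((n : ℝ) + 1) ^ (-1 : ℝ) - (n : ℝ) ^ (-1 : ℝ) : ℝ) : ℂ) =
      -((1 - z) * Complex.log (1 - z)) := by
  have hball : ∀ w : ℂ, ‖w‖ < 1 →
      ∑' n : ℕ, w ^ (n + 1) * ((((n : ℝ) + 1) ^ (-1 : ℝ) - (n : ℝ) ^ (-1 : ℝ) : ℝ) : ℂ) =
      -((1 - w) * Complex.log (1 - w)) := fun w hw => by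
    have hlog : HasSum (fun n : ℕ => w ^ n * (((n : ℝ) ^ (-1 : ℝ) : ℝ) : ℂ)) (-Complex.log (1 - w)) := by
      convert! Complex.hasSum_taylorSeries_neg_log hw using 1
      funext n
      rw [Real.rpow_neg_one, div_eq_mul_inv]
      push_cast
      rfl
    rw [(hasSum_polylog_by_parts one_pos hlog.summable).tsum_eq, hlog.tsum_eq]
    ring
  have hre : 0 < (1 - z).re := by
    rw [Complex.sub_re, Complex.one_re, sub_pos]
    refine lt_of_le_of_ne ((Complex.re_le_norm z).trans hz) fun h => hz1 ?_
    have hsq := Complex.sq_norm z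
    rw [Complex.normSq_apply, h] at hsq
    have : z.im = 0 := by nlinarith [norm_nonneg z]
    exact Complex.ext (by simpa using h) (by simpa using this)
  have hr : Tendsto (fun r : ℝ => (r : ℂ) * z) (nhdsWithin 1 (Set.Iio 1)) (nhds z) := by
    have : Tendsto (fun r : ℝ => (r : ℂ) * z) (nhds 1) (nhds ((1 : ℝ) * z)) :=
      (Complex.continuous_ofReal.mul continuous_const).tendsto 1
    rw [Complex.ofReal_one, one_mul] at this
    exact this.mono_left nhdsWithin_le_nhds
  have hI : Set.Ioo (0 : ℝ) 1 ∈ nhdsWithin (1 : ℝ) (Set.Iio 1) := Ioo_mem_nhdsLT one_pos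
  have hnorm : ∀ r ∈ Set.Ioo (0 : ℝ) 1, ‖(r : ℂ) * z‖ < 1 := fun r hr => by
    rw [norm_mul, Complex.norm_real, Real.norm_of_nonneg hr.1.le]
    nlinarith [hr.1, hr.2, norm_nonneg z]
  have hlim : Tendsto (fun r : ℝ => ∑' n : ℕ, ((r : ℂ) * z) ^ (n + 1) *
      ((((n : ℝ) + 1) ^ (-1 : ℝ) - (n : ℝ) ^ (-1 : ℝ) : ℝ) : ℂ)) (nhdsWithin 1 (Set.Iio 1))
      (nhds (∑' n : ℕ, z ^ (n + 1) *
        ((((n : ℝ) + 1) ^ (-1 : ℝ) - (n : ℝ) ^ (-1 : ℝ) : ℝ) : ℂ))) := by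
    refine tendsto_tsum_of_dominated_convergence summable_rpow_sub_bound
      (fun n => (hr.pow _).mul_const _) ?_
    filter_upwards [hI] with r hr n
    rw [norm_mul, Complex.norm_real, norm_pow]
    refine (mul_le_of_le_one_left (norm_nonneg _) (pow_le_one₀ (norm_nonneg _) (hnorm r hr).le)).trans ?_
    exact abs_rpow_sub_rpow_le le_rfl (by norm_num) n
  have hlim' : Tendsto (fun r : ℝ => -((1 - (r : ℂ) * z) * Complex.log (1 - (r : ℂ) * z)))
      (nhdsWithin 1 (Set.Iio 1)) (nhds (-((1 - z) * Complex.log (1 - z)))) := by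
    have h1 := tendsto_const_nhds (x := (1 : ℂ)) |>.sub hr
    exact (h1.mul (h1.clog (Or.inl hre))).neg
  refine tendsto_nhds_unique hlim (hlim'.congr' ?_)
  filter_upwards [hI] with r hr
  rw [hball _ (hnorm r hr)]

theorem summable_polylog {z : ℂ} (hz : ‖z‖ ≤ 1) {s : ℝ} (hs : 1 < s) :
    Summable fun n : ℕ => z ^ n * (((n : ℝ) ^ (-s) : ℝ) : ℂ) := by
  refine Summable.of_norm_bounded ((Real.summable_nat_rpow (p := -s)).mpr (by linarith)) fun n => ?_
  rw [norm_mul, norm_pow, Complex.norm_real, Real.norm_of_nonneg (by positivity)]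
  exact mul_le_of_le_one_left (by positivity) (pow_le_one₀ (norm_nonneg _) hz)

/-- As `s` decreases to `1`, the polylogarithm of order `s` converges on the unit circle. -/
theorem tendsto_polylog {z : ℂ} (hz : ‖z‖ ≤ 1) (hz1 : z ≠ 1) :
    Tendsto (fun s : ℝ => ∑' n : ℕ, z ^ n * (((n : ℝ) ^ (-s) : ℝ) : ℂ)) (nhdsWithin 1 (Set.Ioi 1))
      (nhds (-Complex.log (1 - z))) := by
  have h1z : 1 - z ≠ 0 := sub_ne_zero.mpr hz1.symm
  have hlim : Tendsto (fun s : ℝ => ∑' n : ℕ, z ^ (n + 1) *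
      ((((n : ℝ) + 1) ^ (-s) - (n : ℝ) ^ (-s) : ℝ) : ℂ)) (nhdsWithin 1 (Set.Ioi 1))
      (nhds (∑' n : ℕ, z ^ (n + 1) *
        ((((n : ℝ) + 1) ^ (-1 : ℝ) - (n : ℝ) ^ (-1 : ℝ) : ℝ) : ℂ))) := by
    refine tendsto_tsum_of_dominated_convergence summable_rpow_sub_bound (fun n => ?_) ?_
    · exact ((Complex.continuous_ofReal.tendsto _).comp
        (tendsto_rpow_neg_nhds_one.sub tendsto_rpow_neg_nhds_one)).const_mul _
    · filter_upwards [Ioo_mem_nhdsGT (show (1 : ℝ) < 2 by norm_num)] with s hs n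
      rw [norm_mul, Complex.norm_real, norm_pow]
      refine (mul_le_of_le_one_left (norm_nonneg _) (pow_le_one₀ (norm_nonneg _) hz)).trans ?_
      exact abs_rpow_sub_rpow_le hs.1.le hs.2.le n
  rw [tsum_polylog_one_eq hz hz1] at hlim
  have h := hlim.const_mul (1 - z)⁻¹
  rw [show (1 - z)⁻¹ * -((1 - z) * Complex.log (1 - z)) = -Complex.log (1 - z) by field_simp] at h
  refine h.congr' ?_
  filter_upwards [self_mem_nhdsWithin] with s hs
  have hs : 1 < s := hs
  rw [(hasSum_polylog_by_parts (by linarith) (summable_polylog hz hs)).tsum_eq]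
  field_simp

/-- If a character is a finite combination of geometric progressions, the value at `1` of its
`L`-function is the corresponding combination of logarithms. -/
theorem tendsto_charL {N : ℕ} {ι : Type*} (χ : MulChar (ZMod N) ℤ) (S : Finset ι) (c : ℂ)
    (w z : ι → ℂ) (hz : ∀ a ∈ S, ‖z a‖ ≤ 1) (hz1 : ∀ a ∈ S, z a ≠ 1)
    (h : ∀ n : ℕ, c * (χ n : ℂ) = ∑ a ∈ S, w a * z a ^ n) :
    Tendsto (fun s : ℝ => c * (charL χ s : ℂ)) (nhdsWithin 1 (Set.Ioi 1))
      (nhds (-∑ a ∈ S, w a * Complex.log (1 - z a))) := by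
  have key : Tendsto
      (fun s : ℝ => ∑ a ∈ S, w a * ∑' n : ℕ, z a ^ n * (((n : ℝ) ^ (-s) : ℝ) : ℂ))
      (nhdsWithin 1 (Set.Ioi 1)) (nhds (∑ a ∈ S, w a * -Complex.log (1 - z a))) :=
    tendsto_finsetSum _ fun a ha => (tendsto_polylog (hz a ha) (hz1 a ha)).const_mul (w a)
  simp only [mul_neg, Finset.sum_neg_distrib] at key
  refine key.congr' ?_
  filter_upwards [self_mem_nhdsWithin] with s hs
  simp only [← tsum_mul_left]
  rw [← Summable.tsum_finsetSum fun a ha => (summable_polylog (hz a ha) hs).mul_left (w a), charL,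
    Complex.ofReal_tsum, ← tsum_mul_left]
  refine tsum_congr fun n => ?_
  push_cast
  rw [← mul_assoc, h, Finset.sum_mul]
  exact Finset.sum_congr rfl fun a _ => by ring

theorem arg_add_arg_of_mul_eq {z w u : ℂ} (hz : 0 < z.re) (hw : 0 < w.re) {r : ℝ} (hr : 0 < r)
    (h : z * w = r * u) : Complex.arg z + Complex.arg w = Complex.arg u := by
  have hz' := Complex.abs_arg_lt_pi_div_two_iff.mpr (Or.inl hz)
  have hw' := Complex.abs_arg_lt_pi_div_two_iff.mpr (Or.inl hw)
  rw [abs_lt] at hz' hw'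
  have h0 : z ≠ 0 := fun h => by simp [h] at hz
  have h1 : w ≠ 0 := fun h => by simp [h] at hw
  rw [← Complex.arg_mul h0 h1 ⟨by linarith, by linarith⟩, h, Complex.arg_real_mul _ hr]

theorem tendsto_charL_chi8' :
    Tendsto (charL ZMod.χ₈') (nhdsWithin 1 (Set.Ioi 1)) (nhds (π / (2 * √2))) := by
  have h2 : √2 * √2 = 2 := Real.mul_self_sqrt (by norm_num)
  have h20 : 0 < √2 := by positivity
  have h2lt : √2 < 2 := by nlinarith
  set ω : ℂ := ⟨√2 / 2, √2 / 2⟩ with hω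
  have hωsq : ω ^ 2 = Complex.I := by
    apply Complex.ext <;> simp [hω, pow_two] <;> nlinarith
  have hω4 : ω ^ 4 = -1 := by
    rw [show ω ^ 4 = (ω ^ 2) ^ 2 by ring, hωsq, Complex.I_sq]
  have hω3 : ω ^ 3 = ⟨-(√2 / 2), √2 / 2⟩ := by
    rw [pow_succ, hωsq]
    apply Complex.ext <;> simp [hω]
  have hω5 : ω ^ 5 = ⟨-(√2 / 2), -(√2 / 2)⟩ := by
    rw [pow_succ, hω4]
    apply Complex.ext <;> simp [hω]
  have hω7 : ω ^ 7 = ⟨√2 / 2, -(√2 / 2)⟩ := by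
    rw [show ω ^ 7 = ω ^ 4 * ω ^ 3 by ring, hω4, hω3]
    apply Complex.ext <;> simp
  have hsum : ω + ω ^ 3 = √2 * Complex.I := by
    rw [hω3, hω]
    apply Complex.ext <;> simp
  have hnorm : ‖ω‖ = 1 := by
    have := congrArg norm hωsq
    rw [norm_pow, Complex.norm_I] at this
    exact (pow_eq_one_iff_of_nonneg (norm_nonneg _) two_ne_zero).mp this
  have hchar : ∀ n : ℕ, (2 * √2 * Complex.I) * (ZMod.χ₈' n : ℂ) =
      ∑ a ∈ ({1, 3, 5, 7} : Finset ℕ), (ZMod.χ₈' a : ℂ) * (ω ^ a) ^ n := by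
    intro n
    have hω8 : ω ^ 8 = 1 := by rw [show ω ^ 8 = (ω ^ 4) ^ 2 by ring, hω4]; norm_num
    have hmod (a : ℕ) : (ω ^ a) ^ n = (ω ^ a) ^ (n % 8) := by
      conv_lhs => rw [← Nat.div_add_mod n 8, pow_add, pow_mul, ← pow_mul ω a 8, mul_comm a 8,
        pow_mul ω, hω8, one_pow, one_pow, one_mul]
    have hlt : n % 8 < 8 := Nat.mod_lt _ (by norm_num)
    simp only [hmod, ZMod.χ₈'_nat_eq_if_mod_eight,
      show n % 2 = n % 8 % 2 by lia]
    generalize n % 8 = m at hlt ⊢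
    interval_cases m <;> norm_num <;> grind
  have hlim := tendsto_charL ZMod.χ₈' {1, 3, 5, 7} (2 * √2 * Complex.I)
    (fun a : ℕ => (ZMod.χ₈' a : ℂ)) (fun a => ω ^ a) (fun a _ => by rw [norm_pow, hnorm, one_pow])
    (fun a ha => by
      simp only [Finset.mem_insert, Finset.mem_singleton] at ha
      rcases ha with rfl | rfl | rfl | rfl
      · rw [pow_one]
        exact fun h => by simpa [hω] using congrArg Complex.im h
      · exact fun h => by simpa [hω3] using congrArg Complex.im h
      · exact fun h => by simpa [hω5] using congrArg Complex.im h
      · exact fun h => by simpa [hω7] using congrArg Complex.im h) hchar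
  have hneg : Complex.arg (1 - ω) + Complex.arg (1 - ω ^ 3) = -(π / 2) := by
    rw [← Complex.arg_neg_I]
    refine arg_add_arg_of_mul_eq ?_ ?_ h20 (by linear_combination hω4 - hsum)
    · simp [hω]; linarith
    · simp [hω3]; linarith
  have hpos : Complex.arg (1 - ω ^ 5) + Complex.arg (1 - ω ^ 7) = π / 2 := by
    rw [← Complex.arg_I]
    refine arg_add_arg_of_mul_eq ?_ ?_ h20
      (by linear_combination (ω ^ 8 - ω ^ 4 - ω ^ 3 - ω + 1) * hω4 + hsum)
    · simp [hω5]; linarith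
    · simp [hω7]; linarith
  have him := ((Complex.continuous_im.tendsto _).comp hlim).div_const (2 * √2)
  have hval : (-∑ a ∈ ({1, 3, 5, 7} : Finset ℕ),
      (ZMod.χ₈' a : ℂ) * Complex.log (1 - ω ^ a)).im = π := by
    simp [Complex.log_im]
    linarith
  rw [hval] at him
  refine him.congr fun s => ?_
  simp

/-- The nonzero quadratic residues modulo `29`. -/
def residues29 : Finset ℕ := {1, 4, 5, 6, 7, 9, 13, 16, 20, 22, 23, 24, 25, 28}

/-- The quadratic nonresidues modulo `29`. -/
def nonresidues29 : Finset ℕ := {2, 3, 8, 10, 11, 12, 14, 15, 17, 18, 19, 21, 26, 27}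

theorem prod_residues29 {K : Type*} [CommRing K] {x : K} (h : x ^ 29 = 1) :
    ∏ a ∈ residues29, (1 - x ^ a) =
      14 - 3 * ∑ a ∈ residues29, x ^ a + 2 * ∑ a ∈ nonresidues29, x ^ a := by
  have h1 : (1 - x) * (1 - x ^ 28) = 2 - x - x ^ 28 := by
    linear_combination h
  have h4 : (1 - x) * (1 - x ^ 28) * ((1 - x ^ 4) * (1 - x ^ 25)) =
      -2 * x ^ 28 + x ^ 26 - 2 * x ^ 25 + x ^ 24 + x ^ 5 - 2 * x ^ 4 + x ^ 3 - 2 * x + 4 := by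
    linear_combination (1 - x ^ 4) * (1 - x ^ 25) * h1 +
      (-x ^ 28 + x ^ 24 + x ^ 3 - x + 2) * h
  have h5 : (1 - x) * (1 - x ^ 28) * ((1 - x ^ 4) * (1 - x ^ 25)) * ((1 - x ^ 5) * (1 - x ^ 24)) =
      -2 * x ^ 28 - x ^ 27 + 2 * x ^ 26 - 2 * x ^ 25 - 2 * x ^ 24 + 2 * x ^ 23 - x ^ 21 + 2 * x
      ^ 20 - x ^ 19 - x ^ 10 + 2 * x ^ 9 - x ^ 8 + 2 * x ^ 6 - 2 * x ^ 5 - 2 * x ^ 4 + 2 * x ^ 3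
      - x ^ 2 - 2 * x + 6 := by
    linear_combination (1 - x ^ 5) * (1 - x ^ 24) * h4 +
      (-2 * x ^ 28 + x ^ 26 - 2 * x ^ 25 + x ^ 24 + 2 * x ^ 23 - x ^ 21 + 2 * x ^ 20 - x ^ 19 + x
      ^ 5 + x ^ 3 - x ^ 2 + 2) * h
  have h6 : (1 - x) * (1 - x ^ 28) * ((1 - x ^ 4) * (1 - x ^ 25)) * ((1 - x ^ 5) * (1 - x ^ 24)) * ((1
      - x ^ 6) * (1 - x ^ 23)) =
      -2 * x ^ 28 + x ^ 27 - 2 * x ^ 25 - 2 * x ^ 24 - 2 * x ^ 23 + 2 * x ^ 22 - x ^ 21 + 2 * x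
      ^ 20 + 2 * x ^ 18 - 2 * x ^ 17 + x ^ 16 - x ^ 15 - x ^ 14 + x ^ 13 - 2 * x ^ 12 + 2 * x ^
      11 + 2 * x ^ 9 - x ^ 8 + 2 * x ^ 7 - 2 * x ^ 6 - 2 * x ^ 5 - 2 * x ^ 4 + x ^ 2 - 2 * x + 8 := by
    linear_combination (1 - x ^ 6) * (1 - x ^ 23) * h5 +
      (-2 * x ^ 28 - x ^ 27 + 2 * x ^ 26 - 2 * x ^ 25 - 2 * x ^ 24 + 2 * x ^ 23 + 2 * x ^ 22 + x
      ^ 19 + 2 * x ^ 18 - 2 * x ^ 17 + x ^ 15 - 2 * x ^ 14 + x ^ 13 - x ^ 10 + 2 * x ^ 9 - x ^ 8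
      + 2 * x ^ 6 - 2 * x ^ 3 + 2 * x ^ 2 + 2) * h
  have h7 : (1 - x) * (1 - x ^ 28) * ((1 - x ^ 4) * (1 - x ^ 25)) * ((1 - x ^ 5) * (1 - x ^ 24)) * ((1
      - x ^ 6) * (1 - x ^ 23)) * ((1 - x ^ 7) * (1 - x ^ 22)) =
      -x ^ 28 + 2 * x ^ 27 + 2 * x ^ 26 - 6 * x ^ 25 - 3 * x ^ 24 - 3 * x ^ 23 - 3 * x ^ 22 + x
      ^ 21 + 2 * x ^ 20 + 2 * x ^ 19 + 4 * x ^ 18 - 2 * x ^ 17 + 2 * x ^ 16 - 3 * x ^ 15 - 3 * x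
      ^ 14 + 2 * x ^ 13 - 2 * x ^ 12 + 4 * x ^ 11 + 2 * x ^ 10 + 2 * x ^ 9 + x ^ 8 - 3 * x ^ 7 -
      3 * x ^ 6 - 3 * x ^ 5 - 6 * x ^ 4 + 2 * x ^ 3 + 2 * x ^ 2 - x + 12 := by
    linear_combination (1 - x ^ 7) * (1 - x ^ 22) * h6 +
      (-2 * x ^ 28 + x ^ 27 - 2 * x ^ 25 - 2 * x ^ 24 - 2 * x ^ 23 + 2 * x ^ 22 + x ^ 21 + x ^ 20
      + 4 * x ^ 18 + 3 * x ^ 16 - 3 * x ^ 15 - x ^ 13 - 2 * x ^ 12 + 2 * x ^ 10 + x ^ 9 + 3 * x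
      ^ 7 - x ^ 6 - x ^ 5 - 4 * x ^ 4 + 2 * x ^ 3 + x ^ 2 + x + 4) * h
  have h9 : (1 - x) * (1 - x ^ 28) * ((1 - x ^ 4) * (1 - x ^ 25)) * ((1 - x ^ 5) * (1 - x ^ 24)) * ((1
      - x ^ 6) * (1 - x ^ 23)) * ((1 - x ^ 7) * (1 - x ^ 22)) * ((1 - x ^ 9) * (1 - x ^ 20)) =
      -5 * x ^ 28 + 3 * x ^ 27 + 9 * x ^ 26 - 11 * x ^ 25 + 3 * x ^ 24 - 5 * x ^ 23 - 10 * x ^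
      22 + 5 * x ^ 21 - 12 * x ^ 20 + 3 * x ^ 19 + 4 * x ^ 18 - 7 * x ^ 17 + 13 * x ^ 16 + 13 *
      x ^ 13 - 7 * x ^ 12 + 4 * x ^ 11 + 3 * x ^ 10 - 12 * x ^ 9 + 5 * x ^ 8 - 10 * x ^ 7 - 5 *
      x ^ 6 + 3 * x ^ 5 - 11 * x ^ 4 + 9 * x ^ 3 + 3 * x ^ 2 - 5 * x + 20 := by
    linear_combination (1 - x ^ 9) * (1 - x ^ 20) * h7 +
      (-x ^ 28 + 2 * x ^ 27 + 2 * x ^ 26 - 6 * x ^ 25 - 3 * x ^ 24 - 3 * x ^ 23 - 3 * x ^ 22 + x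
      ^ 21 + 2 * x ^ 20 + 3 * x ^ 19 + 2 * x ^ 18 - 4 * x ^ 17 + 8 * x ^ 16 + 5 * x ^ 13 - 3 * x
      ^ 12 + 2 * x ^ 11 - 2 * x ^ 9 + 4 * x ^ 8 - 7 * x ^ 7 - 2 * x ^ 6 + 6 * x ^ 5 - 5 * x ^ 4
      + 7 * x ^ 3 + x ^ 2 - 4 * x + 8) * h
  have h13 : (1 - x) * (1 - x ^ 28) * ((1 - x ^ 4) * (1 - x ^ 25)) * ((1 - x ^ 5) * (1 - x ^ 24)) * ((1
      - x ^ 6) * (1 - x ^ 23)) * ((1 - x ^ 7) * (1 - x ^ 22)) * ((1 - x ^ 9) * (1 - x ^ 20)) *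
      ((1 - x ^ 13) * (1 - x ^ 16)) =
      -3 * x ^ 28 + 2 * x ^ 27 + 2 * x ^ 26 - 3 * x ^ 25 - 3 * x ^ 24 - 3 * x ^ 23 - 3 * x ^ 22
      + 2 * x ^ 21 - 3 * x ^ 20 + 2 * x ^ 19 + 2 * x ^ 18 + 2 * x ^ 17 - 3 * x ^ 16 + 2 * x ^ 15
      + 2 * x ^ 14 - 3 * x ^ 13 + 2 * x ^ 12 + 2 * x ^ 11 + 2 * x ^ 10 - 3 * x ^ 9 + 2 * x ^ 8 -
      3 * x ^ 7 - 3 * x ^ 6 - 3 * x ^ 5 - 3 * x ^ 4 + 2 * x ^ 3 + 2 * x ^ 2 - 3 * x + 14 := by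
    linear_combination (1 - x ^ 13) * (1 - x ^ 16) * h9 +
      (-5 * x ^ 28 + 3 * x ^ 27 + 9 * x ^ 26 - 11 * x ^ 25 + 3 * x ^ 24 - 5 * x ^ 23 - 10 * x ^
      22 + 5 * x ^ 21 - 12 * x ^ 20 + 3 * x ^ 19 + 4 * x ^ 18 - 7 * x ^ 17 + 13 * x ^ 16 + 5 * x
      ^ 15 - 3 * x ^ 14 + 4 * x ^ 13 + 9 * x ^ 12 - 2 * x ^ 11 - x ^ 10 + 9 * x ^ 9 - 3 * x ^ 8
      + 7 * x ^ 7 + 2 * x ^ 6 - 6 * x ^ 5 + 8 * x ^ 4 - 7 * x ^ 3 - x ^ 2 + 2 * x - 6) * h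
  simp only [residues29, nonresidues29, Finset.prod_insert, Finset.sum_insert, Finset.mem_insert, Finset.mem_singleton,
    Finset.prod_singleton, Finset.sum_singleton, pow_one, Nat.reduceEqDiff, or_self,
    not_false_eq_true, OfNat.one_ne_ofNat]
  linear_combination h13

theorem quadraticChar_of_mem_residues29 :
    ∀ a ∈ residues29, quadraticChar (ZMod 29) a = 1 := by
  decide

theorem quadraticChar_of_mem_nonresidues29 :
    ∀ a ∈ nonresidues29, quadraticChar (ZMod 29) a = -1 := by
  decide

theorem range_29_eq : Finset.range 29 = {0} ∪ (residues29 ∪ nonresidues29) := by decide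

theorem nonresidues29_eq_image : nonresidues29 = residues29.image fun a => 2 * a % 29 := by decide

theorem residues29_eq_image : residues29 = nonresidues29.image fun a => 2 * a % 29 := by decide

theorem injOn_two_mul_residues29 : Set.InjOn (fun a => 2 * a % 29) residues29 := by decide

theorem injOn_two_mul_nonresidues29 : Set.InjOn (fun a => 2 * a % 29) nonresidues29 := by decide

theorem sum_quadraticChar_mul (f : ℕ → ℂ) :
    ∑ a : ZMod 29, (quadraticChar (ZMod 29) a : ℂ) * f a.val =
      ∑ a ∈ residues29, f a - ∑ a ∈ nonresidues29, f a := by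
  have h : ∑ a : ZMod 29, (quadraticChar (ZMod 29) a : ℂ) * f a.val =
      ∑ k ∈ Finset.range 29, (quadraticChar (ZMod 29) k : ℂ) * f k := by
    rw [Finset.sum_range]
    refine Fintype.sum_congr (α := Fin 29) _ _ fun a => ?_
    exact congrArg (fun b : ZMod 29 => (quadraticChar (ZMod 29) b : ℂ) * f a)
      (ZMod.natCast_zmod_val (n := 29) a).symm
  have hR : ∑ k ∈ residues29, (quadraticChar (ZMod 29) k : ℂ) * f k = ∑ k ∈ residues29, f k :=
    Finset.sum_congr rfl fun a ha => by rw [quadraticChar_of_mem_residues29 a ha]; simp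
  have hN : ∑ k ∈ nonresidues29, (quadraticChar (ZMod 29) k : ℂ) * f k =
      -∑ k ∈ nonresidues29, f k := by
    rw [← Finset.sum_neg_distrib]
    exact Finset.sum_congr rfl fun a ha => by rw [quadraticChar_of_mem_nonresidues29 a ha]; simp
  rw [h, range_29_eq, Finset.sum_union (by decide), Finset.sum_union (by decide), hR, hN]
  simp
  ring

theorem gaussSum_zmodChar_eq {ζ : ℂ} (hζ : ζ ^ 29 = 1) :
    gaussSum ((quadraticChar (ZMod 29)).ringHomComp (Int.castRingHom ℂ)) (AddChar.zmodChar 29 hζ) =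
      ∑ a ∈ residues29, ζ ^ a - ∑ a ∈ nonresidues29, ζ ^ a := by
  rw [← sum_quadraticChar_mul]
  simp [gaussSum, AddChar.zmodChar_apply]

theorem gaussSum_mul_quadraticChar {ζ : ℂ} (hζ : ζ ^ 29 = 1) (n : ℕ) :
    (∑ a ∈ residues29, ζ ^ a - ∑ a ∈ nonresidues29, ζ ^ a) * (quadraticChar (ZMod 29) n : ℂ) =
      ∑ a ∈ residues29, (ζ ^ a) ^ n - ∑ a ∈ nonresidues29, (ζ ^ a) ^ n := by
  set χ : MulChar (ZMod 29) ℂ := (quadraticChar (ZMod 29)).ringHomComp (Int.castRingHom ℂ) with hχ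
  set ψ : AddChar (ZMod 29) ℂ := AddChar.zmodChar 29 hζ with hψ
  have hg : gaussSum χ ψ = ∑ a ∈ residues29, ζ ^ a - ∑ a ∈ nonresidues29, ζ ^ a :=
    gaussSum_zmodChar_eq hζ
  have hg' : gaussSum χ (ψ.mulShift n) =
      ∑ a ∈ residues29, (ζ ^ a) ^ n - ∑ a ∈ nonresidues29, (ζ ^ a) ^ n := by
    rw [← sum_quadraticChar_mul fun a => (ζ ^ a) ^ n]
    refine Finset.sum_congr rfl fun a _ => ?_
    rw [AddChar.mulShift_apply, ← nsmul_eq_mul, AddChar.map_nsmul_eq_pow]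
    simp [hχ, hψ, AddChar.zmodChar_apply]
  rw [← hg, ← hg']
  rcases eq_or_ne (n : ZMod 29) 0 with h0 | h0
  · have hd : 29 ∣ n := (ZMod.natCast_eq_zero_iff n 29).mp h0
    obtain ⟨m, rfl⟩ := hd
    rw [hg']
    simp only [h0, ← pow_mul, mul_left_comm _ 29]
    simp only [pow_mul ζ 29, hζ, one_pow]
    simp [residues29, nonresidues29]
  · have h1 := gaussSum_mulShift χ ψ (Units.mk0 _ h0)
    have h2 : (quadraticChar (ZMod 29) n : ℂ) * (quadraticChar (ZMod 29) n : ℂ) = 1 := by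
      rw [← pow_two]
      exact_mod_cast quadraticChar_sq_one h0
    simp only [Units.val_mk0] at h1
    have h3 : χ (n : ZMod 29) = (quadraticChar (ZMod 29) n : ℂ) := by simp [hχ]
    rw [h3] at h1
    linear_combination (-(quadraticChar (ZMod 29) n : ℂ)) * h1 +
      gaussSum χ (ψ.mulShift n) * h2

theorem gaussSum_sq_twentyNine {ζ : ℂ} (hζ : IsPrimitiveRoot ζ 29) :
    (∑ a ∈ residues29, ζ ^ a - ∑ a ∈ nonresidues29, ζ ^ a) ^ 2 = 29 := by
  rw [← gaussSum_zmodChar_eq hζ.pow_eq_one, gaussSum_sq]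
  · rw [MulChar.ringHomComp_apply, show quadraticChar (ZMod 29) (-1) = 1 by decide, ZMod.card]
    simp
  · intro h
    have h2 := congrArg (fun χ : MulChar (ZMod 29) ℂ => χ 2) h
    simp only [MulChar.ringHomComp_apply, show quadraticChar (ZMod 29) 2 = -1 by decide] at h2
    rw [MulChar.one_apply (by decide)] at h2
    norm_num at h2
  · exact (quadraticChar_isQuadratic (ZMod 29)).comp _
  · exact AddChar.zmodChar_primitive_of_primitive_root 29 hζ

theorem sq_pow_eq_pow_mod {ζ : ℂ} (hζ : ζ ^ 29 = 1) (a : ℕ) :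
    (ζ ^ 2) ^ a = ζ ^ (2 * a % 29) := by
  rw [← pow_mul]
  conv_lhs => rw [← Nat.div_add_mod (2 * a) 29, pow_add, pow_mul, hζ, one_pow, one_mul]

theorem prod_residues29_eq {ζ : ℂ} (hζ : IsPrimitiveRoot ζ 29) :
    ∏ a ∈ residues29, (1 - ζ ^ a) =
      (29 - 5 * (∑ a ∈ residues29, ζ ^ a - ∑ a ∈ nonresidues29, ζ ^ a)) / 2 := by
  have h := hζ.geom_sum_eq_zero (by norm_num)
  rw [range_29_eq, Finset.sum_union (by decide), Finset.sum_union (by decide)] at h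
  rw [prod_residues29 hζ.pow_eq_one]
  simp only [Finset.sum_singleton, pow_zero] at h
  linear_combination -(1 / 2 : ℂ) * h

theorem prod_nonresidues29_eq {ζ : ℂ} (hζ : IsPrimitiveRoot ζ 29) :
    ∏ a ∈ nonresidues29, (1 - ζ ^ a) =
      (29 + 5 * (∑ a ∈ residues29, ζ ^ a - ∑ a ∈ nonresidues29, ζ ^ a)) / 2 := by
  have h := prod_residues29_eq (hζ.pow_of_coprime 2 (by decide))
  simp only [sq_pow_eq_pow_mod hζ.pow_eq_one] at h
  rw [nonresidues29_eq_image, Finset.prod_image injOn_two_mul_residues29, h,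
    ← nonresidues29_eq_image, ← Finset.sum_image (f := fun a => ζ ^ a) injOn_two_mul_residues29,
    ← Finset.sum_image (f := fun a => ζ ^ a) injOn_two_mul_nonresidues29,
    ← nonresidues29_eq_image, ← residues29_eq_image]
  ring

theorem tendsto_charL_twentyNine :
    Tendsto (charL (quadraticChar (ZMod 29))) (nhdsWithin 1 (Set.Ioi 1))
      (nhds (2 * log ((5 + √29) / 2) / √29)) := by
  obtain ⟨ζ, hζ⟩ : ∃ ζ : ℂ, IsPrimitiveRoot ζ 29 := ⟨_, Complex.isPrimitiveRoot_exp 29 (by norm_num)⟩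
  set τ : ℂ := ∑ a ∈ residues29, ζ ^ a - ∑ a ∈ nonresidues29, ζ ^ a with hτ
  have h29 : √29 * √29 = 29 := Real.mul_self_sqrt (by norm_num)
  have h290 : 0 < √29 := by positivity
  have h5 : 5 < √29 := by nlinarith
  have h6 : √29 < 6 := by nlinarith
  have hmem : ∀ a ∈ residues29 ∪ nonresidues29, a ≠ 0 ∧ a < 29 := by decide
  have hne : ∀ a ∈ residues29 ∪ nonresidues29, ζ ^ a ≠ 1 := fun a ha =>
    hζ.pow_ne_one_of_pos_of_lt (hmem a ha).1 (hmem a ha).2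
  have hdisj : Disjoint residues29 nonresidues29 := by decide
  have hsplit (f : ℕ → ℂ) : ∑ a ∈ residues29 ∪ nonresidues29,
      (if a ∈ residues29 then 1 else -1 : ℂ) * f a =
        ∑ a ∈ residues29, f a - ∑ a ∈ nonresidues29, f a := by
    rw [Finset.sum_union hdisj, sub_eq_add_neg, ← Finset.sum_neg_distrib]
    congr 1
    · exact Finset.sum_congr rfl fun a ha => by rw [if_pos ha, one_mul]
    · exact Finset.sum_congr rfl fun a ha => by
        rw [if_neg fun h => Finset.disjoint_left.mp hdisj h ha, neg_one_mul]
  have hlim := tendsto_charL (quadraticChar (ZMod 29)) (residues29 ∪ nonresidues29) τ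
    (fun a => if a ∈ residues29 then 1 else -1) (fun a => ζ ^ a)
    (fun a _ => by rw [norm_pow, hζ.norm'_eq_one (by norm_num), one_pow]) hne
    (fun n => by rw [hτ, gaussSum_mul_quadraticChar hζ.pow_eq_one, ← hsplit])
  have hre := (Complex.continuous_re.tendsto _).comp hlim
  have hlog (S : Finset ℕ) (hS : S ⊆ residues29 ∪ nonresidues29) :
      ∑ a ∈ S, (Complex.log (1 - ζ ^ a)).re = log ‖∏ a ∈ S, (1 - ζ ^ a)‖ := by
    rw [norm_prod, Real.log_prod fun a ha =>
      norm_ne_zero_iff.mpr (sub_ne_zero.mpr (hne a (hS ha)).symm)]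
    exact Finset.sum_congr rfl fun a _ => Complex.log_re _
  rw [hsplit, Complex.neg_re, Complex.sub_re, Complex.re_sum, Complex.re_sum,
    hlog _ Finset.subset_union_left, hlog _ Finset.subset_union_right, prod_residues29_eq hζ,
    prod_nonresidues29_eq hζ, ← hτ] at hre
  have hlogs : log ((29 + 5 * √29) / 2) - log ((29 - 5 * √29) / 2) =
      2 * log ((5 + √29) / 2) := by
    rw [← Real.log_div (by positivity) (by nlinarith), ← Real.log_rpow (by positivity)]
    congr 1
    rw [div_eq_iff (by nlinarith)]
    norm_num
    nlinarith
  have hn1 : ‖(29 + 5 * (√29 : ℂ)) / 2‖ = (29 + 5 * √29) / 2 := by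
    rw [show (29 + 5 * (√29 : ℂ)) / 2 = ((29 + 5 * √29) / 2 : ℝ) by push_cast; rfl,
      Complex.norm_of_nonneg (by positivity)]
  have hn2 : ‖(29 - 5 * (√29 : ℂ)) / 2‖ = (29 - 5 * √29) / 2 := by
    rw [show (29 - 5 * (√29 : ℂ)) / 2 = ((29 - 5 * √29) / 2 : ℝ) by push_cast; rfl,
      Complex.norm_of_nonneg (by nlinarith)]
  have hcases : τ = √29 ∨ τ = -√29 := by
    apply sq_eq_sq_iff_eq_or_eq_neg.mp
    rw [hτ, gaussSum_sq_twentyNine hζ, pow_two, ← Complex.ofReal_mul, h29]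
    norm_num
  rcases hcases with h | h
  · rw [h, hn1, hn2, show -(log ((29 - 5 * √29) / 2) - log ((29 + 5 * √29) / 2)) =
      2 * log ((5 + √29) / 2) by linarith] at hre
    refine (hre.div_const √29).congr fun s => ?_
    simp [h290.ne']
  · rw [h, show (29 - 5 * -(√29 : ℂ)) / 2 = (29 + 5 * (√29 : ℂ)) / 2 by ring,
      show (29 + 5 * -(√29 : ℂ)) / 2 = (29 - 5 * (√29 : ℂ)) / 2 by ring, hn1, hn2, hlogs] at hre
    have := hre.div_const (-√29)
    rw [neg_div_neg_eq] at this
    refine this.congr fun s => ?_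
    simp [h290.ne']

theorem sum_squares_telescope {q : ℝ} {Q : ℕ → ℝ} (hQ : ∀ s, Q s ≠ 0)
    (hq : ∀ s : ℕ, 1 + q ^ s ≠ 0)
    (hrec : ∀ s, Q (s + 1) * (1 + q ^ (s + 1)) = Q s * (1 - q ^ (s + 1))) (n m : ℕ) :
    ∑ s ∈ Finset.range (m + 1), (-1) ^ s * (2 / ((1 + q ^ s) * Q s)) * q ^ (s * n) *
      (q ^ s * (1 - q ^ n) - (1 + q ^ n)) = 2 * (-1) ^ (m + 1) * q ^ ((m + 1) * n) / Q m := by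
  induction m with
  | zero =>
    have := hQ 0
    simp
    field_simp
    ring
  | succ m ih =>
    rw [Finset.sum_range_succ, ih]
    have h1 := hQ m
    have h2 := hQ (m + 1)
    have h3 := hq (m + 1)
    have h4 : 1 / Q m = (1 - q ^ (m + 1)) / ((1 + q ^ (m + 1)) * Q (m + 1)) := by
      rw [div_eq_div_iff h1 (mul_ne_zero h3 h2)]
      linear_combination hrec m
    rw [div_eq_mul_one_div _ (Q m), h4]
    field_simp
    ring

/-- A finite form of Gauss's identity for `∑ (-1)^n q^(n²)`. -/
theorem sum_squares_eq {q : ℝ} {Q : ℕ → ℝ} (hQ : ∀ s, Q s ≠ 0) (hq : ∀ s : ℕ, 1 + q ^ s ≠ 0)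
    (hrec : ∀ s, Q (s + 1) * (1 + q ^ (s + 1)) = Q s * (1 - q ^ (s + 1))) (n : ℕ) :
    1 + 2 * ∑ s ∈ Finset.range n, (-1) ^ (s + 1) * q ^ (s + 1) ^ 2 =
      Q n * ∑ s ∈ Finset.range (n + 1),
        (-1) ^ s * (2 / ((1 + q ^ s) * Q s)) * q ^ (s * (n + 1)) := by
  induction n with
  | zero =>
    have := hQ 0
    simp
    field_simp
    norm_num
  | succ n ih =>
    have h := sum_squares_telescope hQ hq hrec (n + 1) n
    have h1 := hQ n
    have h2 := hQ (n + 1)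
    have h3 := hq (n + 1)
    have h5 : Q (n + 1) = Q n * (1 - q ^ (n + 1)) / (1 + q ^ (n + 1)) := by
      rw [← hrec, mul_div_cancel_right₀ _ h3]
    rw [Finset.sum_range_succ, mul_add, ← add_assoc, ih, Finset.sum_range_succ _ (n + 1), mul_add]
    have e1 : Q (n + 1) * ∑ s ∈ Finset.range (n + 1),
        (-1) ^ s * (2 / ((1 + q ^ s) * Q s)) * q ^ (s * (n + 1 + 1)) =
        Q n * ∑ s ∈ Finset.range (n + 1),
          (-1) ^ s * (2 / ((1 + q ^ s) * Q s)) * q ^ (s * (n + 1)) +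
        Q n / (1 + q ^ (n + 1)) * (2 * (-1) ^ (n + 1) * q ^ ((n + 1) * (n + 1)) / Q n) := by
      rw [← h, Finset.mul_sum, Finset.mul_sum, Finset.mul_sum, ← Finset.sum_add_distrib]
      refine Finset.sum_congr rfl fun s _ => ?_
      have h6 := hQ s
      have h7 := hq s
      rw [h5]
      field_simp
      ring
    rw [e1]
    field_simp
    ring_nf

theorem sum_triangular_telescope {q : ℝ} {Q : ℕ → ℝ} (hQ : ∀ s, Q s ≠ 0)
    (hrec : ∀ s, Q (s + 1) * (1 - q ^ (2 * s + 1)) = Q s * (1 - q ^ (2 * s + 2))) (n m : ℕ) :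
    ∑ s ∈ Finset.range (m + 1), 1 / Q s * q ^ (s * (2 * n + 1)) *
      (q ^ (2 * s) * (1 - q ^ (2 * n + 2)) - (1 - q ^ (2 * n + 1))) =
        q ^ ((m + 1) * (2 * n + 1)) * (1 - q ^ (2 * m + 1)) / Q m := by
  induction m with
  | zero =>
    have := hQ 0
    simp
    field_simp
    ring
  | succ m ih =>
    rw [Finset.sum_range_succ, ih]
    have h1 := hQ m
    have h2 := hQ (m + 1)
    have h4 := hrec m
    have h5 : (1 - q ^ (2 * m + 1)) / Q m = (1 - q ^ (2 * m + 2)) / Q (m + 1) := by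
      rw [div_eq_div_iff h1 h2]
      linear_combination h4
    rw [mul_div_assoc, h5]
    field_simp
    ring

/-- A finite form of Gauss's identity for `∑ q^(n(n+1)/2)`. -/
theorem sum_triangular_eq {q : ℝ} {Q : ℕ → ℝ} (hQ : ∀ s, Q s ≠ 0)
    (hq : ∀ s : ℕ, 1 - q ^ (2 * s + 1) ≠ 0)
    (hrec : ∀ s, Q (s + 1) * (1 - q ^ (2 * s + 1)) = Q s * (1 - q ^ (2 * s + 2))) (n : ℕ) :
    ∑ s ∈ Finset.range n, (q ^ (s * (2 * s + 1)) + q ^ ((s + 1) * (2 * s + 1))) =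
      Q n * ∑ s ∈ Finset.range n, 1 / Q s * q ^ (s * (2 * n + 1)) := by
  induction n with
  | zero => simp
  | succ n ih =>
    have h := sum_triangular_telescope hQ hrec n n
    have h1 := hQ n
    have h3 := hq n
    have h5 : Q (n + 1) = Q n * (1 - q ^ (2 * n + 2)) / (1 - q ^ (2 * n + 1)) := by
      rw [← hrec, mul_div_cancel_right₀ _ h3]
    have e1 : Q (n + 1) * ∑ s ∈ Finset.range (n + 1), 1 / Q s * q ^ (s * (2 * (n + 1) + 1)) =
        Q n * ∑ s ∈ Finset.range (n + 1), 1 / Q s * q ^ (s * (2 * n + 1)) +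
        Q n / (1 - q ^ (2 * n + 1)) *
          (q ^ ((n + 1) * (2 * n + 1)) * (1 - q ^ (2 * n + 1)) / Q n) := by
      rw [← h, Finset.mul_sum, Finset.mul_sum, Finset.mul_sum, ← Finset.sum_add_distrib]
      refine Finset.sum_congr rfl fun s _ => ?_
      have h6 := hQ s
      rw [h5]
      field_simp
      ring
    rw [Finset.sum_range_succ, ih, e1, Finset.sum_range_succ]
    field_simp
    ring

theorem tendsto_prod_one_sub {q : ℝ} (hq0 : 0 < q) (hq1 : q < 1) {f : ℕ → ℕ}
    (hf : Function.Injective f) (hf0 : ∀ j, f j ≠ 0) :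
    ∃ p : ℝ, 0 < p ∧ p = ∏' j, (1 - q ^ f j) ∧
      Tendsto (fun n => ∏ j ∈ Finset.range n, (1 - q ^ f j)) atTop (nhds p) := by
  have hs : Summable fun j => -q ^ f j :=
    ((summable_geometric_of_lt_one hq0.le hq1).comp_injective hf).neg
  have hpos : ∀ j, 0 < 1 - q ^ f j := fun j => sub_pos.mpr (pow_lt_one₀ hq0.le hq1 (hf0 j))
  have ht : Tendsto (fun n => ∏ j ∈ Finset.range n, (1 - q ^ f j)) atTop
      (nhds (∏' j, (1 - q ^ f j))) := by
    simpa only [← sub_eq_add_neg] using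
      (Real.multipliable_one_add_of_summable hs).tendsto_prod_tprod_nat
  refine ⟨_, lt_of_le_of_ne ?_ (Ne.symm ?_), rfl, ht⟩
  · exact ge_of_tendsto' ht fun n => Finset.prod_nonneg fun j _ => (hpos j).le
  · have := tprod_one_add_ne_zero_of_summable (f := fun j => -q ^ f j)
      (fun j => by rw [← sub_eq_add_neg]; exact (hpos j).ne') hs.norm
    simpa only [← sub_eq_add_neg] using this

theorem tendsto_sum_squares {q : ℝ} (hq0 : 0 < q) (hq1 : q < 1) {Q : ℕ → ℝ} {c : ℝ}
    (h01 : Q 0 = 1) (hQ0 : ∀ s, 0 < Q s)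
    (hrec : ∀ s, Q (s + 1) * (1 + q ^ (s + 1)) = Q s * (1 - q ^ (s + 1)))
    (hc : Tendsto Q atTop (nhds c)) :
    Tendsto (fun n => 1 + 2 * ∑ s ∈ Finset.range n, (-1) ^ (s + 1) * q ^ (s + 1) ^ 2) atTop
      (nhds c) := by
  have hq : ∀ s : ℕ, 0 < q ^ s := fun s => by positivity
  have hanti : Antitone Q := antitone_nat_of_succ_le fun s => by
    have := hrec s
    have h1 := hQ0 s
    have h2 := hQ0 (s + 1)
    nlinarith [hq (s + 1), mul_pos h1 (hq (s + 1)), mul_pos h2 (hq (s + 1))]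
  have hz : Tendsto (fun n : ℕ => 2 * (n * q ^ n)) atTop (nhds 0) := by
    simpa using (tendsto_self_mul_const_pow_of_lt_one hq0.le hq1).const_mul 2
  have hd : Tendsto (fun n => (1 + 2 * ∑ s ∈ Finset.range n, (-1) ^ (s + 1) * q ^ (s + 1) ^ 2) - Q n)
      atTop (nhds 0) := by
    refine squeeze_zero_norm (fun n => ?_) hz
    rw [sum_squares_eq (fun s => (hQ0 s).ne') (fun s => by positivity) hrec,
      Finset.sum_range_succ', mul_add]
    have h0 : Q n * ((-1) ^ 0 * (2 / ((1 + q ^ 0) * Q 0)) * q ^ (0 * (n + 1))) = Q n := by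
      simp [h01]
      norm_num
    rw [h0, add_sub_cancel_right, Finset.mul_sum]
    refine (norm_sum_le_of_le _ fun s hs => ?_).trans (b := ∑ s ∈ Finset.range n, 2 * q ^ n) ?_
    · have hQs := hQ0 (s + 1)
      have hle : Q n ≤ Q (s + 1) := hanti (Finset.mem_range.mp hs)
      have h1 : q ^ ((s + 1) * (n + 1)) ≤ q ^ n :=
        pow_le_pow_of_le_one hq0.le hq1.le (by nlinarith)
      have hQn := hQ0 n
      rw [norm_mul, norm_mul, norm_mul, norm_pow, norm_neg, norm_one, one_pow, one_mul,
        Real.norm_of_nonneg hQn.le, Real.norm_of_nonneg (by positivity),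
        Real.norm_of_nonneg (by positivity), ← mul_assoc]
      refine mul_le_mul ?_ h1 (by positivity) (by norm_num)
      rw [mul_div_assoc', div_le_iff₀ (by positivity)]
      nlinarith [mul_pos (hq (s + 1)) hQs]
    · rw [Finset.sum_const, Finset.card_range, nsmul_eq_mul]
      exact le_of_eq (by ring)
  simpa using hd.add hc

theorem tendsto_sum_triangular {q : ℝ} (hq0 : 0 < q) (hq1 : q < 1) {Q : ℕ → ℝ} {c : ℝ}
    (h01 : Q 0 = 1) (hQ0 : ∀ s, 0 < Q s)
    (hrec : ∀ s, Q (s + 1) * (1 - q ^ (2 * s + 1)) = Q s * (1 - q ^ (2 * s + 2)))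
    (hc : Tendsto Q atTop (nhds c)) :
    Tendsto (fun n => ∑ s ∈ Finset.range n, (q ^ (s * (2 * s + 1)) + q ^ ((s + 1) * (2 * s + 1))))
      atTop (nhds c) := by
  have hlt : ∀ s : ℕ, 0 < 1 - q ^ (2 * s + 1) := fun s =>
    sub_pos.mpr (pow_lt_one₀ hq0.le hq1 (by lia))
  have hmono : Monotone Q := monotone_nat_of_le_succ fun s => by
    have h1 : q ^ (2 * s + 2) ≤ q ^ (2 * s + 1) := pow_le_pow_of_le_one hq0.le hq1.le (by lia)
    refine le_of_mul_le_mul_right ?_ (hlt s)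
    rw [hrec s]
    exact mul_le_mul_of_nonneg_left (by linarith) (hQ0 s).le
  have hz : Tendsto (fun n : ℕ => c * ((n + 1 : ℕ) * q ^ (n + 1))) atTop (nhds 0) := by
    simpa using ((tendsto_add_atTop_iff_nat 1).mpr
      (tendsto_self_mul_const_pow_of_lt_one hq0.le hq1)).const_mul c
  have hd : Tendsto (fun n => ∑ s ∈ Finset.range (n + 1),
      (q ^ (s * (2 * s + 1)) + q ^ ((s + 1) * (2 * s + 1))) - Q (n + 1)) atTop (nhds 0) := by
    refine squeeze_zero_norm (fun n => ?_) hz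
    have hc0 : 0 ≤ c := (hQ0 0).le.trans (hmono.ge_of_tendsto hc 0)
    rw [sum_triangular_eq (fun s => (hQ0 s).ne') (fun s => (hlt s).ne') hrec,
      Finset.sum_range_succ', mul_add]
    have h0 : Q (n + 1) * (1 / Q 0 * q ^ (0 * (2 * (n + 1) + 1))) = Q (n + 1) := by simp [h01]
    rw [h0, add_sub_cancel_right, Finset.mul_sum]
    refine (norm_sum_le_of_le _ fun s hs => ?_).trans
      (b := ∑ s ∈ Finset.range n, c * q ^ (n + 1)) ?_
    · have hQs : 1 ≤ Q (s + 1) := h01 ▸ hmono (Nat.zero_le (s + 1))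
      have hQn := hQ0 (n + 1)
      rw [norm_mul, norm_mul, Real.norm_of_nonneg hQn.le, Real.norm_of_nonneg (by positivity),
        Real.norm_of_nonneg (by positivity)]
      refine mul_le_mul (hmono.ge_of_tendsto hc _) ?_ (by positivity) hc0
      calc 1 / Q (s + 1) * q ^ ((s + 1) * (2 * (n + 1) + 1))
          ≤ 1 * q ^ (n + 1) := mul_le_mul ((div_le_one (by linarith)).mpr hQs)
            (pow_le_pow_of_le_one hq0.le hq1.le (by nlinarith)) (by positivity) zero_le_one
        _ = q ^ (n + 1) := one_mul _
    · rw [Finset.sum_const, Finset.card_range, nsmul_eq_mul]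
      have : 0 ≤ c * q ^ (n + 1) := by positivity
      push_cast
      nlinarith
  have := hd.add ((tendsto_add_atTop_iff_nat 1).mpr hc)
  rw [← tendsto_add_atTop_iff_nat 1]
  simpa using this

/-- Gauss's product formulas combined: `∑ (-1)^n q^(n²) = P³ ∑ q^(n(n+1)/2)` with
`P = ∏ (1 - q^(2j+1))`. -/
theorem exists_gauss_limits {q : ℝ} (hq0 : 0 < q) (hq1 : q < 1) :
    ∃ c : ℝ, 0 < c ∧
      Tendsto (fun n => 1 + 2 * ∑ s ∈ Finset.range n, (-1) ^ (s + 1) * q ^ (s + 1) ^ 2) atTop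
        (nhds ((∏' j : ℕ, (1 - q ^ (2 * j + 1))) ^ 3 * c)) ∧
      Tendsto (fun n => ∑ s ∈ Finset.range n,
        (q ^ (s * (2 * s + 1)) + q ^ ((s + 1) * (2 * s + 1)))) atTop (nhds c) := by
  obtain ⟨P, hP0, hP, hPt⟩ := tendsto_prod_one_sub hq0 hq1 (f := fun j => 2 * j + 1)
    (fun a b h => by simpa using h) (by simp)
  obtain ⟨E, hE0, -, hEt⟩ := tendsto_prod_one_sub hq0 hq1 (f := fun j => 2 * j + 2)
    (fun a b h => by simpa using h) (by simp)
  obtain ⟨A, hA0, -, hAt⟩ := tendsto_prod_one_sub hq0 hq1 (f := fun j => j + 1)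
    (fun a b h => by simpa using h) (by simp)
  have hpos : ∀ j, 0 < 1 - q ^ (j + 1) := fun j =>
    sub_pos.mpr (pow_lt_one₀ hq0.le hq1 (by lia))
  have hA : A = P * E := by
    refine tendsto_nhds_unique (hAt.comp (tendsto_id.const_mul_atTop' (r := 2) two_pos)) ?_
    refine (hPt.mul hEt).congr fun n => ?_
    induction n with
    | zero => simp
    | succ n ih =>
      simp only [Function.comp_apply, id_eq] at ih ⊢
      rw [Finset.prod_range_succ, Finset.prod_range_succ, show 2 * (n + 1) = 2 * n + 1 + 1 by ring,
        Finset.prod_range_succ _ (2 * n + 1), Finset.prod_range_succ _ (2 * n), ← ih]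
      ring
  have hB (n : ℕ) : ∏ j ∈ Finset.range n, (1 + q ^ (j + 1)) =
      (∏ j ∈ Finset.range n, (1 - q ^ (2 * j + 2))) / ∏ j ∈ Finset.range n, (1 - q ^ (j + 1)) := by
    rw [← Finset.prod_div_distrib]
    refine Finset.prod_congr rfl fun j _ => ?_
    rw [eq_div_iff (hpos j).ne']
    ring
  refine ⟨E / P, by positivity, ?_, ?_⟩
  · rw [← hP]
    refine tendsto_sum_squares hq0 hq1
      (Q := fun n => ∏ j ∈ Finset.range n, (1 - q ^ (j + 1)) / (1 + q ^ (j + 1))) (by simp)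
      (fun n => Finset.prod_pos fun j _ => div_pos (hpos j) (by positivity))
      (fun n => ?_) ?_
    · rw [Finset.prod_range_succ]
      have : 1 + q ^ (n + 1) ≠ 0 := by positivity
      field_simp
    · simp only [Finset.prod_div_distrib, hB]
      have h := hAt.div (hEt.div hAt hA0.ne') (by positivity)
      convert! h using 2
      rw [hA]
      field_simp
  · refine tendsto_sum_triangular hq0 hq1
      (Q := fun n => ∏ j ∈ Finset.range n, (1 - q ^ (2 * j + 2)) / (1 - q ^ (2 * j + 1))) (by simp)
      (fun n => Finset.prod_pos fun j _ => div_pos (hpos (2 * j + 1)) (hpos (2 * j)))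
      (fun n => ?_) ?_
    · rw [Finset.prod_range_succ]
      have := (hpos (2 * n)).ne'
      field_simp
    · simp only [Finset.prod_div_distrib]
      exact hEt.div hPt hP0.ne.symm

/-- The one-variable Jacobi theta function `θ₄(q) = ∑_{n ∈ ℤ} (-1)^n q^(n²)`. -/
noncomputable def theta4 (q : ℝ) : ℝ := ∑' n : ℤ, (-1) ^ n * q ^ ((n : ℝ) ^ 2)

/-- A sum over pairs of integers splits by whether the coordinates have the same parity. -/
theorem tsum_parity_split {F : ℤ × ℤ → ℝ} (hF : Summable F) :
    ∑' p, F p = ∑' p : ℤ × ℤ, F (p.1 + p.2, p.1 - p.2) +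
      ∑' p : ℤ × ℤ, F (p.1 + p.2 + 1, p.1 - p.2) := by
  let g : (ℤ × ℤ) ⊕ (ℤ × ℤ) → ℤ × ℤ :=
    Sum.elim (fun p => (p.1 + p.2, p.1 - p.2)) fun p => (p.1 + p.2 + 1, p.1 - p.2)
  have hg : Function.Bijective g := by
    constructor
    · rintro (⟨a, b⟩ | ⟨a, b⟩) (⟨c, d⟩ | ⟨c, d⟩) h <;>
        simp only [g, Sum.elim_inl, Sum.elim_inr, Prod.mk.injEq] at h
      · congr 2 <;> lia
      · lia
      · lia
      · congr 2 <;> lia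
    · rintro ⟨m, n⟩
      rcases Int.even_or_odd' (m + n) with ⟨k, hk | hk⟩
      · exact ⟨Sum.inl (k, m - k), by simp only [g, Sum.elim_inl, Prod.mk.injEq]; lia⟩
      · exact ⟨Sum.inr (k, m - k - 1), by simp only [g, Sum.elim_inr, Prod.mk.injEq]; lia⟩
  have h := (Equiv.ofBijective g hg).summable_iff.mpr hF
  rw [← (Equiv.ofBijective g hg).tsum_eq, Summable.tsum_sum]
  · rfl
  · exact h.comp_injective Sum.inl_injective
  · exact h.comp_injective Sum.inr_injective

theorem summable_rpow_int_add_sq {q : ℝ} (hq0 : 0 < q) (hq1 : q < 1) (c : ℝ) :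
    Summable fun n : ℤ => q ^ (((n : ℝ) + c) ^ 2) := by
  have hlog : log q < 0 := Real.log_neg hq0 hq1
  have h := summable_pow_mul_jacobiTheta₂_term_bound (-(log q) / π * |c|) (T := -(log q) / π)
    (div_pos (by linarith) Real.pi_pos) 0
  refine Summable.of_nonneg_of_le (fun n => by positivity) (fun n => ?_) h
  rw [pow_zero, one_mul, Real.rpow_def_of_pos hq0, Real.exp_le_exp]
  have h1 : -π * (-log q / π * (n : ℝ) ^ 2 - 2 * (-log q / π * |c|) * ((|n| : ℤ) : ℝ)) =
      log q * ((n : ℝ) ^ 2 - 2 * (|c| * |(n : ℝ)|)) := by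
    push_cast
    field_simp
    ring
  rw [h1]
  refine mul_le_mul_of_nonpos_left ?_ hlog.le
  have h2 : -(|c| * |(n : ℝ)|) ≤ c * n := by rw [← abs_mul]; exact neg_abs_le _
  nlinarith [sq_nonneg c]

theorem summable_rpow_int_sq {q : ℝ} (hq0 : 0 < q) (hq1 : q < 1) :
    Summable fun n : ℤ => q ^ ((n : ℝ) ^ 2) := by
  simpa using summable_rpow_int_add_sq hq0 hq1 0

theorem summable_norm_theta4 {q : ℝ} (hq0 : 0 < q) (hq1 : q < 1) :
    Summable fun n : ℤ => ‖(-1) ^ n * q ^ ((n : ℝ) ^ 2)‖ := by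
  refine (summable_rpow_int_sq hq0 hq1).congr fun n => ?_
  rw [norm_mul, norm_zpow, norm_neg, norm_one, one_zpow, one_mul,
    Real.norm_of_nonneg (by positivity)]

theorem theta3_sq {q : ℝ} (hq0 : 0 < q) (hq1 : q < 1) :
    theta3 q ^ 2 = theta3 (q ^ 2) ^ 2 + theta2 (q ^ 2) ^ 2 := by
  have hs := (summable_rpow_int_sq hq0 hq1).norm
  have hq20 : 0 < q ^ 2 := by positivity
  have hq21 : q ^ 2 < 1 := pow_lt_one₀ hq0.le hq1 two_ne_zero
  have hs3 := (summable_rpow_int_sq hq20 hq21).norm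
  have hs2 := (summable_rpow_int_add_sq hq20 hq21 (1 / 2)).norm
  simp only [pow_two (theta3 _), pow_two (theta2 _)]
  simp only [theta3, theta2]
  rw [tsum_mul_tsum_of_summable_norm hs hs, tsum_mul_tsum_of_summable_norm hs3 hs3,
    tsum_mul_tsum_of_summable_norm hs2 hs2, tsum_parity_split (summable_mul_of_summable_norm hs hs)]
  simp only [← Real.rpow_natCast_mul hq0.le, ← Real.rpow_add hq0]
  congr 1 <;> refine tsum_congr fun p => ?_ <;> congr 1 <;> push_cast <;> ring

theorem theta4_sq {q : ℝ} (hq0 : 0 < q) (hq1 : q < 1) :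
    theta4 q ^ 2 = theta3 (q ^ 2) ^ 2 - theta2 (q ^ 2) ^ 2 := by
  have hs := summable_norm_theta4 hq0 hq1
  have hq20 : 0 < q ^ 2 := by positivity
  have hq21 : q ^ 2 < 1 := pow_lt_one₀ hq0.le hq1 two_ne_zero
  have hs3 := (summable_rpow_int_sq hq20 hq21).norm
  have hs2 := (summable_rpow_int_add_sq hq20 hq21 (1 / 2)).norm
  have hsign (a b : ℤ) : (-1 : ℝ) ^ (a + b) * (-1) ^ (a - b) = 1 := by
    rw [← zpow_add₀ (by norm_num), show a + b + (a - b) = 2 * a by ring, zpow_mul]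
    norm_num
  simp only [pow_two (theta3 _), pow_two (theta2 _), pow_two (theta4 _)]
  simp only [theta3, theta2, theta4]
  rw [tsum_mul_tsum_of_summable_norm hs hs, tsum_mul_tsum_of_summable_norm hs3 hs3,
    tsum_mul_tsum_of_summable_norm hs2 hs2, tsum_parity_split (summable_mul_of_summable_norm hs hs),
    sub_eq_add_neg, ← tsum_neg]
  simp only [← Real.rpow_natCast_mul hq0.le, ← Real.rpow_add hq0]
  congr 1 <;> refine tsum_congr fun p => ?_
  · rw [mul_mul_mul_comm, hsign, one_mul, ← Real.rpow_add hq0]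
    congr 1
    push_cast
    ring
  · rw [zpow_add_one₀ (by norm_num), mul_mul_mul_comm,
      mul_right_comm ((-1 : ℝ) ^ (p.1 + p.2)) (-1), hsign, one_mul, neg_one_mul, ← Real.rpow_add hq0]
    congr 2
    push_cast
    ring

theorem theta2_sq {q : ℝ} (hq0 : 0 < q) (hq1 : q < 1) :
    theta2 q ^ 2 = 2 * (theta2 (q ^ 2) * theta3 (q ^ 2)) := by
  have hs := (summable_rpow_int_add_sq hq0 hq1 (1 / 2)).norm
  have hq20 : 0 < q ^ 2 := by positivity
  have hq21 : q ^ 2 < 1 := pow_lt_one₀ hq0.le hq1 two_ne_zero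
  have hs3 := (summable_rpow_int_sq hq20 hq21).norm
  have hs3' := (summable_rpow_int_add_sq hq20 hq21 1).norm
  have hs2 := (summable_rpow_int_add_sq hq20 hq21 (1 / 2)).norm
  have hshift : theta3 (q ^ 2) = ∑' n : ℤ, (q ^ 2) ^ (((n : ℝ) + 1) ^ 2) := by
    rw [theta3, ← (Equiv.addRight (1 : ℤ)).tsum_eq]
    simp
  have htwo : 2 * (theta2 (q ^ 2) * theta3 (q ^ 2)) = theta2 (q ^ 2) * theta3 (q ^ 2) +
      (∑' n : ℤ, (q ^ 2) ^ (((n : ℝ) + 1) ^ 2)) * theta2 (q ^ 2) := by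
    rw [← hshift]
    ring
  rw [htwo, pow_two]
  simp only [theta3, theta2]
  rw [tsum_mul_tsum_of_summable_norm hs hs, tsum_mul_tsum_of_summable_norm hs2 hs3,
    tsum_mul_tsum_of_summable_norm hs3' hs2, tsum_parity_split (summable_mul_of_summable_norm hs hs)]
  simp only [← Real.rpow_natCast_mul hq0.le, ← Real.rpow_add hq0]
  congr 1 <;> refine tsum_congr fun p => ?_ <;> congr 1 <;> push_cast <;> ring

/-- Jacobi's quartic identity. -/
theorem theta3_pow_four {q : ℝ} (hq0 : 0 < q) (hq1 : q < 1) :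
    theta3 q ^ 4 = theta2 q ^ 4 + theta4 q ^ 4 := by
  have h2 := theta2_sq hq0 hq1
  have h3 := theta3_sq hq0 hq1
  have h4 := theta4_sq hq0 hq1
  rw [show theta3 q ^ 4 = (theta3 q ^ 2) ^ 2 by ring, show theta2 q ^ 4 = (theta2 q ^ 2) ^ 2 by ring,
    show theta4 q ^ 4 = (theta4 q ^ 2) ^ 2 by ring, h2, h3, h4]
  ring

theorem rpow_sqrt_half_sq {q : ℝ} (hq0 : 0 < q) (n : ℕ) :
    √q ^ (((n : ℝ) + 1 / 2) ^ 2) = q ^ (1 / 8 : ℝ) * q ^ (n * (n + 1) / 2) := by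
  have hdiv : ((n * (n + 1) / 2 : ℕ) : ℝ) = n * (n + 1) / 2 := by
    rw [Nat.cast_div (Nat.even_mul_succ_self n).two_dvd two_ne_zero]
    push_cast
    ring
  rw [Real.sqrt_eq_rpow, ← Real.rpow_mul hq0.le, ← Real.rpow_natCast q (n * (n + 1) / 2), hdiv,
    ← Real.rpow_add hq0]
  congr 1
  ring

theorem sum_triangular_pairs (q : ℝ) (n : ℕ) :
    ∑ s ∈ Finset.range n, (q ^ (s * (2 * s + 1)) + q ^ ((s + 1) * (2 * s + 1))) =
      ∑ s ∈ Finset.range (2 * n), q ^ (s * (s + 1) / 2) := by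
  induction n with
  | zero => simp
  | succ n ih =>
    have e1 : 2 * n * (2 * n + 1) / 2 = n * (2 * n + 1) := by
      rw [mul_assoc, Nat.mul_div_cancel_left _ two_pos]
    have e2 : (2 * n + 1) * (2 * n + 1 + 1) / 2 = (n + 1) * (2 * n + 1) := by
      rw [show (2 * n + 1) * (2 * n + 1 + 1) = 2 * ((n + 1) * (2 * n + 1)) by ring,
        Nat.mul_div_cancel_left _ two_pos]
    rw [Finset.sum_range_succ, ih, show 2 * (n + 1) = 2 * n + 1 + 1 by ring,
      Finset.sum_range_succ _ (2 * n + 1), Finset.sum_range_succ _ (2 * n), e1, e2, add_assoc]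

theorem theta2_sqrt_eq {q c : ℝ} (hq0 : 0 < q) (hq1 : q < 1)
    (hc : Tendsto (fun n => ∑ s ∈ Finset.range n,
      (q ^ (s * (2 * s + 1)) + q ^ ((s + 1) * (2 * s + 1)))) atTop (nhds c)) :
    theta2 √q = 2 * q ^ (1 / 8 : ℝ) * c := by
  have hq20 : 0 < √q := by positivity
  have hq21 : √q < 1 := by rw [Real.sqrt_lt' one_pos]; simpa using hq1
  have hs := summable_rpow_int_add_sq hq20 hq21 (1 / 2)
  have hneg (n : ℕ) : √q ^ (((-((n : ℤ) + 1) : ℤ) + 1 / 2 : ℝ) ^ 2) =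
      √q ^ (((n : ℝ) + 1 / 2) ^ 2) := by
    congr 1
    push_cast
    ring
  have hs1 : Summable fun n : ℕ => √q ^ (((n : ℝ) + 1 / 2) ^ 2) := by
    simpa [Function.comp_def] using hs.comp_injective (i := fun n : ℕ => (n : ℤ)) Nat.cast_injective
  have htri : Summable fun n : ℕ => q ^ (n * (n + 1) / 2) := by
    refine (hs1.mul_left (q ^ (1 / 8 : ℝ))⁻¹).congr fun n => ?_
    rw [rpow_sqrt_half_sq hq0, inv_mul_cancel_left₀ (by positivity)]
  have hsum : ∑' n : ℕ, q ^ (n * (n + 1) / 2) = c := by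
    simp only [sum_triangular_pairs] at hc
    exact tendsto_nhds_unique (htri.hasSum.tendsto_sum_nat.comp
      (tendsto_id.const_mul_atTop' (r := 2) two_pos)) hc
  rw [theta2, tsum_of_nat_of_neg_add_one (f := fun n : ℤ => √q ^ (((n : ℝ) + 1 / 2) ^ 2))
    (by simpa only [Int.cast_natCast] using hs1) (by simpa only [hneg] using hs1)]
  simp only [hneg, Int.cast_natCast, rpow_sqrt_half_sq hq0, tsum_mul_left, hsum]
  ring

theorem theta4_eq {q c : ℝ} (hq0 : 0 < q) (hq1 : q < 1)
    (hc : Tendsto (fun n => 1 + 2 * ∑ s ∈ Finset.range n, (-1) ^ (s + 1) * q ^ (s + 1) ^ 2) atTop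
      (nhds c)) : theta4 q = c := by
  have hs : Summable fun n : ℤ => (-1) ^ n * q ^ ((n : ℝ) ^ 2) :=
    (summable_norm_theta4 hq0 hq1).of_norm
  have heven : (fun n : ℤ => (-1) ^ n * q ^ ((n : ℝ) ^ 2)).Even := fun n => by
    rcases Int.even_or_odd n with h | h <;> simp [h.neg_one_zpow]
  have hs1 := hs.comp_injective (i := fun n : ℕ => (n : ℤ) + 1) fun a b h => by simpa using h
  rw [theta4, tsum_int_of_even heven hs]
  refine tendsto_nhds_unique ((hs1.hasSum.tendsto_sum_nat.const_mul 2).const_add _) (hc.congr ?_)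
  intro n
  congr 1
  · simp
  · congr 1
    refine Finset.sum_congr rfl fun s _ => ?_
    simp only [Function.comp_apply]
    rw [← Real.rpow_natCast]
    push_cast
    norm_cast

theorem theta_quotient_eq {q : ℝ} (hq0 : 0 < q) (hq1 : q < 1) :
    (1 - (theta2 q ^ 2 / theta3 q ^ 2) ^ 2) / (2 * (theta2 q ^ 2 / theta3 q ^ 2)) =
      (∏' j : ℕ, (1 - q ^ (2 * j + 1))) ^ 12 / (8 * √q) := by
  obtain ⟨c, hc0, h4, h2⟩ := exists_gauss_limits hq0 hq1
  set P := ∏' j : ℕ, (1 - q ^ (2 * j + 1))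
  have hq20 : 0 < √q := by positivity
  have hq21 : √q < 1 := by rw [Real.sqrt_lt' one_pos]; simpa using hq1
  have e4 := theta4_eq hq0 hq1 h4
  have e2 := theta2_sq hq20 hq21
  rw [theta2_sqrt_eq hq0 hq1 h2, Real.sq_sqrt hq0.le] at e2
  have ej := theta3_pow_four hq0 hq1
  rw [e4] at ej
  have hq8 : (q ^ (1 / 8 : ℝ)) ^ 4 = √q := by
    rw [Real.sqrt_eq_rpow, ← Real.rpow_natCast, ← Real.rpow_mul hq0.le]
    norm_num
  have hprod : theta2 q * theta3 q = 2 * (q ^ (1 / 8 : ℝ)) ^ 2 * c ^ 2 := by linarith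
  have hpos : theta2 q * theta3 q ≠ 0 := by rw [hprod]; positivity
  have h20 : theta2 q ≠ 0 := left_ne_zero_of_mul hpos
  have h30 : theta3 q ≠ 0 := right_ne_zero_of_mul hpos
  have hsq : (theta2 q * theta3 q) ^ 2 = 4 * √q * c ^ 4 := by rw [hprod, ← hq8]; ring
  have hlhs : (1 - (theta2 q ^ 2 / theta3 q ^ 2) ^ 2) / (2 * (theta2 q ^ 2 / theta3 q ^ 2)) =
      (theta3 q ^ 4 - theta2 q ^ 4) / (2 * (theta2 q * theta3 q) ^ 2) := by
    field_simp
  rw [hlhs, hsq, ej]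
  field_simp
  ring

theorem log_prod_eq {q : ℝ} (hq : q = exp (-(π * √58))) :
    4 * log (∏' j : ℕ, (1 - q ^ (2 * j + 1))) + π * √58 / 6 - log 2 =
      2 * log ((5 + √29) / 2) := by
  have hlim := ((tendsto_charL_chi8'.mul tendsto_charL_twentyNine).const_mul 2).congr'
    (eventually_nhdsWithin_of_forall fun s (hs : s ∈ Set.Ioi (1 : ℝ)) => (tsum_repDiff_eq hs).symm)
  have heq := tendsto_nhds_unique (tendsto_tsum_repDiff hq) hlim
  have h58 : √58 = √2 * √29 := by
    rw [← Real.sqrt_mul (by norm_num)]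
    norm_num
  have hsq : √58 ^ 2 = 58 := Real.sq_sqrt (by norm_num)
  have h0 : √58 ≠ 0 := by positivity
  have hR : 2 * (π / (2 * √2) * (2 * log ((5 + √29) / 2) / √29)) =
      π / √58 * (2 * log ((5 + √29) / 2)) := by
    rw [h58]
    field_simp
  have hL : π ^ 2 / 6 + 4 * π / √58 * log (∏' j : ℕ, (1 - q ^ (2 * j + 1))) - π * log 2 / √58 =
      π / √58 * (4 * log (∏' j : ℕ, (1 - q ^ (2 * j + 1))) + π * √58 / 6 - log 2) := by
    field_simp
    ring
  rw [hR, hL] at heq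
  exact mul_left_cancel₀ (div_ne_zero Real.pi_ne_zero h0) heq

theorem prod_pow_twelve_eq {q : ℝ} (hq : q = exp (-(π * √58))) :
    (∏' j : ℕ, (1 - q ^ (2 * j + 1))) ^ 12 / (8 * √q) = ((5 + √29) / 2) ^ 6 := by
  have hq0 : 0 < q := hq ▸ exp_pos _
  have hq1 : q < 1 := by
    rw [hq, Real.exp_lt_one_iff, neg_lt_zero]
    positivity
  obtain ⟨p, hp0, hp, -⟩ := tendsto_prod_one_sub hq0 hq1 (f := fun j => 2 * j + 1)
    (fun a b h => by simpa using h) (fun j => by simp)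
  have hlog := log_prod_eq hq
  rw [← hp] at hlog ⊢
  have hlq : log q = -(π * √58) := by rw [hq, Real.log_exp]
  refine Real.log_injOn_pos (Set.mem_Ioi.2 (by positivity)) (Set.mem_Ioi.2 (by positivity)) ?_
  rw [Real.log_div (by positivity) (by positivity), Real.log_mul (by norm_num) (by positivity),
    Real.log_sqrt hq0.le, hlq, Real.log_pow, Real.log_pow, show (8 : ℝ) = 2 ^ 3 by norm_num,
    Real.log_pow]
  push_cast
  linarith

/-- The Ramanujan g-invariant at 58 satisfies `g₅₈² = (5 + √29)/2`; that is, with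
`q = exp(−π√58)` and `k = θ₂(q)²/θ₃(q)²`, one has `((1−k²)/(2k))^(1/6) = (5+√29)/2`. -/
theorem g_58_sq :
    ((1 - kSing 58 ^ 2) / (2 * kSing 58)) ^ ((1 : ℝ) / 6) =
      (5 + Real.sqrt 29) / 2 := by
  have hq1 : exp (-(π * √58)) < 1 := by
    rw [Real.exp_lt_one_iff, neg_lt_zero]
    positivity
  rw [kSing, theta_quotient_eq (exp_pos _) hq1, prod_pow_twelve_eq rfl, ← Real.rpow_natCast,
    ← Real.rpow_mul (by positivity)]
  norm_num
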